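/- Let (W,S) be an irreducible Coxeter system such that W is infinite and the canonical bilinear form is not positive semidefinite (i.e., W is non-spherical and non-affine). If w ∈ W is an essential element, then the cyclic subgroup ⟨w⟩ = {w^m : m ∈ ℤ} has finite index in the centralizer of w in W. -/

import Mathlib

/-!
Statement 3: Let (W,S) be an irreducible Coxeter system such that W is infinite and the
canonical bilinear form is not positive semidefinite (i.e., W is non-spherical and non-affine).
If w ∈ W is an essential element, then the cyclic subgroup ⟨w⟩ = {w^m : m ∈ ℤ} has finite index
in the centralizer of w in W.
-/

noncomputable section

namespace CoxeterPaper

variable {B : Type*} {W : Type*} [Group W]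

/-- The entry `⟨α_s, α_t⟩` of the canonical bilinear form: `-cos (π / m_{s,t})` if
`m_{s,t} < ∞`, and `-1` if `m_{s,t} = ∞` (encoded by `M s t = 0`). -/
noncomputable def formEntry (M : CoxeterMatrix B) (s t : B) : ℝ :=
  if M s t = 0 then -1 else -Real.cos (Real.pi / (M s t : ℝ))

/-- The canonical bilinear form on `V = ⊕_{s ∈ S} ℝ α_s`, identified with `B → ℝ` via the
basis of simple roots. -/
noncomputable def canonicalForm [Fintype B] (M : CoxeterMatrix B) (x y : B → ℝ) : ℝ :=
  ∑ s, ∑ t, x s * y t * formEntry M s t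

/-- The Coxeter graph of `M`: vertex set `B`, with `s, t` joined by an edge iff `m_{s,t} ≥ 3`
(where `m_{s,t} = ∞` is encoded by `M s t = 0`). -/
def coxeterGraph (M : CoxeterMatrix B) : SimpleGraph B :=
  SimpleGraph.fromRel (fun s t => M s t = 0 ∨ 3 ≤ M s t)

/-- The standard parabolic subgroup `W_X`, generated by the simple reflections indexed by `X`. -/
def standardParabolic {M : CoxeterMatrix B} (cs : CoxeterSystem M W) (X : Set B) : Subgroup W :=
  Subgroup.closure (cs.simple '' X)

/-- A parabolic subgroup of `W`: a conjugate `w W_X w⁻¹` of a standard parabolic subgroup. -/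
def IsParabolic {M : CoxeterMatrix B} (cs : CoxeterSystem M W) (P : Subgroup W) : Prop :=
  ∃ (w : W) (X : Set B), P = (standardParabolic cs X).map (MulAut.conj w).toMonoidHom

/-- `w` is essential: it does not lie in any proper parabolic subgroup of `W`. -/
def IsEssential {M : CoxeterMatrix B} (cs : CoxeterSystem M W) (w : W) : Prop :=
  ∀ P : Subgroup W, IsParabolic cs P → P ≠ ⊤ → w ∉ P

section EntriesAndChebyshev

open Classical in
/-- The simple root `α_s`. -/
def simpleRoot (s : B) : B → ℝ := Pi.single s 1

lemma simpleRoot_self (s : B) : simpleRoot s s = 1 := by simp [simpleRoot]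

lemma simpleRoot_of_ne {s t : B} (h : t ≠ s) : simpleRoot s t = 0 := by simp [simpleRoot, h]

lemma simpleRoot_nonneg (s t : B) : 0 ≤ simpleRoot s t := by
  by_cases h : t = s
  · subst h; simp [simpleRoot_self]
  · simp [simpleRoot_of_ne h]

variable (M : CoxeterMatrix B)

lemma formEntry_symm (s t : B) : formEntry M s t = formEntry M t s := by
  simp [formEntry, M.symmetric s t]

lemma formEntry_self (s : B) : formEntry M s s = 1 := by
  simp [formEntry]

lemma two_le_of_ne {s t : B} (h : s ≠ t) (h0 : M s t ≠ 0) : 2 ≤ M s t := by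
  have := M.off_diagonal s t h
  omega

lemma formEntry_nonpos {s t : B} (h : s ≠ t) : formEntry M s t ≤ 0 := by
  unfold formEntry
  split_ifs with h0
  · norm_num
  · have h2 : (2 : ℝ) ≤ M s t := by exact_mod_cast two_le_of_ne M h h0
    have : 0 ≤ Real.cos (Real.pi / M s t) := by
      apply Real.cos_nonneg_of_neg_pi_div_two_le_of_le
      · have : 0 ≤ Real.pi / M s t := by positivity
        linarith [Real.pi_pos]
      · exact div_le_div_of_nonneg_left Real.pi_pos.le (by norm_num) h2
    linarith

lemma formEntry_neg {s t : B} (h : (coxeterGraph M).Adj s t) : formEntry M s t < 0 := by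
  have h' : M s t = 0 ∨ 3 ≤ M s t := by
    rcases h.2 with h | h
    · exact h
    · rwa [M.symmetric] at h
  unfold formEntry
  split_ifs with h0
  · norm_num
  · have h3 : (3 : ℝ) ≤ M s t := by exact_mod_cast h'.resolve_left h0
    have : 0 < Real.cos (Real.pi / M s t) := by
      apply Real.cos_pos_of_mem_Ioo
      constructor
      · have : 0 ≤ Real.pi / M s t := by positivity
        linarith [Real.pi_pos]
      · calc Real.pi / M s t ≤ Real.pi / 3 :=
              div_le_div_of_nonneg_left Real.pi_pos.le (by norm_num) h3
          _ < Real.pi / 2 := by linarith [Real.pi_pos]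
    linarith

/-- The sequence `U_{n-1}(c)` of Chebyshev polynomials of the second kind evaluated at `c`. -/
def cheb (c : ℝ) : ℕ → ℝ
  | 0 => 0
  | 1 => 1
  | n + 2 => 2 * c * cheb c (n + 1) - cheb c n

lemma sin_mul_cheb (θ : ℝ) (n : ℕ) : Real.sin θ * cheb (Real.cos θ) n = Real.sin (n * θ) := by
  induction n using Nat.twoStepInduction with
  | zero => simp [cheb]
  | one => simp [cheb]
  | more n h0 h1 =>
    have h2 := Real.sin_add (n * θ + θ) θ
    have h3 := Real.sin_sub (n * θ + θ) θ
    have e1 : n * θ + θ + θ = (n + 2 : ℕ) * θ := by push_cast; ring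
    have e2 : n * θ + θ = (n + 1 : ℕ) * θ := by push_cast; ring
    rw [e1] at h2
    rw [add_sub_cancel_right] at h3
    rw [e2] at h2 h3
    rw [cheb, mul_sub, h0, h2]
    have : Real.sin θ * (2 * Real.cos θ * cheb (Real.cos θ) (n + 1)) =
      2 * Real.cos θ * (Real.sin θ * cheb (Real.cos θ) (n + 1)) := by ring
    rw [this, h1, h3]
    ring

lemma cheb_one (n : ℕ) : cheb 1 n = n := by
  induction n using Nat.twoStepInduction with
  | zero => simp [cheb]
  | one => simp [cheb]
  | more n h0 h1 => rw [cheb, h0, h1]; push_cast; ring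

lemma sin_pi_div_pos {m : ℕ} (hm : 2 ≤ m) : 0 < Real.sin (Real.pi / m) := by
  have h2 : (2 : ℝ) ≤ m := by exact_mod_cast hm
  apply Real.sin_pos_of_pos_of_lt_pi
  · have := Real.pi_pos; positivity
  · rw [div_lt_iff₀ (by linarith)]
    nlinarith [Real.pi_pos]

lemma cheb_two_mul {m : ℕ} (hm : 2 ≤ m) : cheb (Real.cos (Real.pi / m)) (2 * m) = 0 := by
  have h0 : (m : ℝ) ≠ 0 := by positivity
  have h := sin_mul_cheb (Real.pi / m) (2 * m)
  have e : ((2 * m : ℕ) : ℝ) * (Real.pi / m) = 2 * Real.pi := by push_cast; field_simp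
  rw [e, Real.sin_two_pi] at h
  exact (mul_eq_zero.mp h).resolve_left (sin_pi_div_pos hm).ne'

lemma cheb_two_mul_add_one {m : ℕ} (hm : 2 ≤ m) :
    cheb (Real.cos (Real.pi / m)) (2 * m + 1) = 1 := by
  have h0 : (m : ℝ) ≠ 0 := by positivity
  have h := sin_mul_cheb (Real.pi / m) (2 * m + 1)
  have e : ((2 * m + 1 : ℕ) : ℝ) * (Real.pi / m) = Real.pi / m + 2 * Real.pi := by
    push_cast; field_simp; ring
  rw [e, Real.sin_add_two_pi] at h
  exact mul_left_cancel₀ (sin_pi_div_pos hm).ne' (h.trans (mul_one _).symm)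

lemma cheb_nonneg {m k : ℕ} (hm : 2 ≤ m) (hk : k ≤ m) :
    0 ≤ cheb (Real.cos (Real.pi / m)) k := by
  have h0 : (0 : ℝ) < m := by positivity
  have hk' : (k : ℝ) ≤ m := by exact_mod_cast hk
  have h := sin_mul_cheb (Real.pi / m) k
  have : 0 ≤ Real.sin (k * (Real.pi / m)) := by
    have := Real.pi_pos
    apply Real.sin_nonneg_of_nonneg_of_le_pi
    · positivity
    · rw [← mul_div_assoc, div_le_iff₀ h0]
      nlinarith
  rw [← h] at this
  exact nonneg_of_mul_nonneg_right this (sin_pi_div_pos hm)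

lemma pow_apply_eq_self {E : Type*} [AddCommGroup E] [Module ℝ E] {f : Module.End ℝ E} {y : E}
    (h : f y = y) (n : ℕ) : (f ^ n) y = y := by
  induction n with
  | zero => simp
  | succ n ih => rw [pow_succ, Module.End.mul_apply, h, ih]

end EntriesAndChebyshev

section Geometry

variable [Fintype B]

/-- The canonical bilinear form as a bilinear map. -/
def bil (M : CoxeterMatrix B) : (B → ℝ) →ₗ[ℝ] (B → ℝ) →ₗ[ℝ] ℝ :=
  LinearMap.mk₂ ℝ (canonicalForm M)
    (fun x y z => by
      simp only [canonicalForm, ← Finset.sum_add_distrib, Pi.add_apply, add_mul])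
    (fun c x y => by
      simp only [canonicalForm, Finset.mul_sum, Pi.smul_apply, smul_eq_mul, mul_assoc])
    (fun x y z => by
      simp only [canonicalForm, ← Finset.sum_add_distrib, Pi.add_apply, add_mul, mul_add])
    (fun c x y => by
      simp only [canonicalForm, Finset.mul_sum, Pi.smul_apply, smul_eq_mul]
      exact Finset.sum_congr rfl fun s _ => Finset.sum_congr rfl fun t _ => by ring)

lemma sum_smul_simpleRoot (x : B → ℝ) : ∑ s, x s • simpleRoot s = x := by
  classical
  ext t
  simp [simpleRoot, Pi.single_apply]

variable (M : CoxeterMatrix B)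

lemma bil_apply (x y : B → ℝ) : bil M x y = canonicalForm M x y := rfl

lemma bil_symm (x y : B → ℝ) : bil M x y = bil M y x := by
  simp only [bil_apply, canonicalForm]
  rw [Finset.sum_comm]
  exact Finset.sum_congr rfl fun s _ => Finset.sum_congr rfl fun t _ => by
    rw [formEntry_symm]; ring

lemma bil_simpleRoot (s t : B) : bil M (simpleRoot s) (simpleRoot t) = formEntry M s t := by
  classical
  simp [bil_apply, canonicalForm, simpleRoot, Pi.single_apply]

lemma bil_simpleRoot_self (s : B) : bil M (simpleRoot s) (simpleRoot s) = 1 := by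
  rw [bil_simpleRoot, formEntry_self]

/-- The reflection along a vector `a` (an involution when `a` has norm one). -/
def refl (a : B → ℝ) : Module.End ℝ (B → ℝ) :=
  LinearMap.id - LinearMap.smulRight (2 • bil M a) a

lemma refl_apply (a x : B → ℝ) : refl M a x = x - (2 * bil M a x) • a := by
  simp [refl]

lemma refl_refl {a : B → ℝ} (ha : bil M a a = 1) (x : B → ℝ) : refl M a (refl M a x) = x := by
  simp only [refl_apply, map_sub, map_smul, ha]
  module

lemma bil_refl {a : B → ℝ} (ha : bil M a a = 1) (x y : B → ℝ) :
    bil M (refl M a x) (refl M a y) = bil M x y := by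
  simp only [refl_apply, map_sub, map_smul, LinearMap.sub_apply, LinearMap.smul_apply,
    smul_eq_mul, ha, bil_symm M x a]
  ring

lemma refl_mul_refl_pow_apply {a b : B → ℝ} (ha : bil M a a = 1) (hb : bil M b b = 1)
    (n : ℕ) :
    ((refl M a * refl M b) ^ n) a =
      cheb (-bil M a b) (2 * n + 1) • a + cheb (-bil M a b) (2 * n) • b := by
  induction n with
  | zero => simp [cheb]
  | succ n ih =>
    rw [pow_succ', Module.End.mul_apply, ih]
    have e1 : 2 * (n + 1) + 1 = (2 * n + 1) + 2 := by ring
    have e2 : 2 * (n + 1) = 2 * n + 2 := by ring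
    rw [e1, cheb, show 2 * n + 1 + 1 = 2 * n + 2 by ring, e2, cheb]
    simp only [Module.End.mul_apply, refl_apply, map_add, map_sub, map_smul, ha, hb,
      bil_symm M b a]
    module

lemma simple_refl_isLiftable : M.IsLiftable fun s => refl M (simpleRoot s) := by
  intro s t
  have hs := bil_simpleRoot_self M s
  have ht := bil_simpleRoot_self M t
  by_cases hst : s = t
  · subst hst
    ext1 x
    simp [refl_refl M hs]
  by_cases h0 : M s t = 0
  · simp [h0]
  have hm := two_le_of_ne M hst h0
  set m := M s t with hmdef
  have hc : -bil M (simpleRoot s) (simpleRoot t) = Real.cos (Real.pi / m) := by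
    rw [bil_simpleRoot, formEntry, if_neg h0, neg_neg]
  have hc' : -bil M (simpleRoot t) (simpleRoot s) = Real.cos (Real.pi / m) := by
    rw [bil_symm, hc]
  have h1 := refl_mul_refl_pow_apply M hs ht m
  have h2 := refl_mul_refl_pow_apply M ht hs m
  rw [hc, cheb_two_mul hm, cheb_two_mul_add_one hm, one_smul, zero_smul, add_zero] at h1
  rw [hc', cheb_two_mul hm, cheb_two_mul_add_one hm, one_smul, zero_smul, add_zero] at h2
  set σ := refl M (simpleRoot s) with hσ
  set τ := refl M (simpleRoot t) with hτ
  have hσσ : σ * σ = 1 := LinearMap.ext fun x => refl_refl M hs x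
  have hττ : τ * τ = 1 := LinearMap.ext fun x => refl_refl M ht x
  have hinv : (σ * τ) ^ m * (τ * σ) ^ m = 1 := by
    have hcomm : Commute (σ * τ) (τ * σ) := by
      show σ * τ * (τ * σ) = τ * σ * (σ * τ)
      rw [show σ * τ * (τ * σ) = σ * (τ * τ) * σ by noncomm_ring,
        show τ * σ * (σ * τ) = τ * (σ * σ) * τ by noncomm_ring, hσσ, hττ, mul_one, mul_one,
        hσσ, hττ]
    rw [← hcomm.mul_pow, show σ * τ * (τ * σ) = σ * (τ * τ) * σ by noncomm_ring, hττ, mul_one,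
      hσσ, one_pow]
  have h3 : ((σ * τ) ^ m) (simpleRoot t) = simpleRoot t := by
    conv_lhs => rw [← h2]
    rw [← Module.End.mul_apply, hinv, Module.End.one_apply]
  ext1 x
  set c := bil M (simpleRoot s) (simpleRoot t) with hcdef
  have hcc : 1 - c ^ 2 ≠ 0 := by
    have hsin := sin_pi_div_pos hm
    have := Real.sin_sq_add_cos_sq (Real.pi / m)
    rw [← hc] at this
    have : 1 - c ^ 2 = Real.sin (Real.pi / m) ^ 2 := by linarith
    rw [this]; positivity
  set p := bil M (simpleRoot s) x
  set q := bil M (simpleRoot t) x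
  set a := (p - c * q) / (1 - c ^ 2)
  set b := (q - c * p) / (1 - c ^ 2)
  set y := x - a • simpleRoot s - b • simpleRoot t with hy
  have hys : σ y = y := by
    rw [hσ, refl_apply]
    have : bil M (simpleRoot s) y = 0 := by
      simp only [hy, map_sub, map_smul, smul_eq_mul, hs]
      rw [← hcdef]; simp only [a, b, p, q]; field_simp; ring
    simp [this]
  have hyt : τ y = y := by
    rw [hτ, refl_apply]
    have : bil M (simpleRoot t) y = 0 := by
      simp only [hy, map_sub, map_smul, smul_eq_mul, ht]
      rw [bil_symm M _ (simpleRoot s), ← hcdef]; simp only [a, b, p, q]; field_simp; ring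
    simp [this]
  have hyy : ((σ * τ) ^ m) y = y :=
    pow_apply_eq_self (by rw [Module.End.mul_apply, hyt, hys]) m
  have hx : x = y + a • simpleRoot s + b • simpleRoot t := by rw [hy]; module
  rw [hx, map_add, map_add, map_smul, map_smul, hyy, h1, h3, Module.End.one_apply]

end Geometry

section AlternatingFactor

variable {M : CoxeterMatrix B} (cs : CoxeterSystem M W)

open CoxeterSystem in
lemma exists_alternating_factor (w : W) (s t : B) (hs : ¬ cs.IsRightDescent w s)
    (ht : cs.IsRightDescent w t) :
    ∃ (v : W) (k : ℕ), w = v * cs.wordProd (alternatingWord s t k) ∧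
      cs.length v < cs.length w ∧ ¬ cs.IsRightDescent v s ∧ ¬ cs.IsRightDescent v t ∧
      (M s t = 0 ∨ k + 1 ≤ M s t) := by
  classical
  set p : ℕ → W := fun k => cs.wordProd (alternatingWord s t k) with hp
  set r : ℕ → B := fun k => if Even k then t else s with hr
  have hps : ∀ k, p (k + 1) = cs.simple (r k) * p k := fun k => by
    simp only [hp, hr]; rw [alternatingWord_succ', cs.wordProd_cons]
  have hlen : ∀ k, cs.length (p k) ≤ k := fun k =>
    (cs.length_wordProd_le _).trans (length_alternatingWord s t k).le
  have hvs : ∀ k, w * (p (k + 1))⁻¹ = w * (p k)⁻¹ * cs.simple (r k) := fun k => by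
    rw [hps, mul_inv_rev, cs.inv_simple, mul_assoc]
  have hvs' : ∀ k, w * (p k)⁻¹ = w * (p (k + 1))⁻¹ * cs.simple (r k) := fun k => by
    rw [hvs, cs.simple_mul_simple_cancel_right]
  set P : ℕ → Prop := fun k => cs.length (w * (p k)⁻¹) + k = cs.length w with hP
  have hex : ∃ k, ¬ P k := ⟨cs.length w + 1, by simp only [hP]; omega⟩
  obtain ⟨K, hK, hmin⟩ : ∃ K, ¬ P K ∧ ∀ k < K, P k :=
    ⟨Nat.find hex, Nat.find_spec hex, fun k hk => not_not.mp (Nat.find_min hex hk)⟩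
  have hP0 : P 0 := by simp [hP, hp, alternatingWord]
  have hP1 : P 1 := by
    have h := (cs.isRightDescent_iff).mp ht
    simp only [hP, hvs 0]
    simpa [hp, hr, alternatingWord] using h
  have hK0 : K ≠ 0 := fun h => hK (h ▸ hP0)
  have hK1 : K ≠ 1 := fun h => hK (h ▸ hP1)
  obtain ⟨k, rfl⟩ : ∃ k, K = k + 2 := ⟨K - 2, by omega⟩
  have h1 : P (k + 1) := hmin _ (by omega)
  have h0 : P k := hmin _ (by omega)
  have hdr : ¬ cs.IsRightDescent (w * (p (k + 1))⁻¹) (r (k + 1)) := by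
    intro h
    rw [cs.isRightDescent_iff, ← hvs] at h
    change cs.length (w * (p (k + 2))⁻¹) + 1 = _ at h
    apply hK
    simp only [hP] at h1 ⊢
    omega
  have hdr' : ¬ cs.IsRightDescent (w * (p (k + 1))⁻¹) (r k) := by
    intro h
    rw [cs.isRightDescent_iff, ← hvs'] at h
    simp only [hP] at h0 h1
    omega
  have hst : ¬ cs.IsRightDescent (w * (p (k + 1))⁻¹) s ∧
      ¬ cs.IsRightDescent (w * (p (k + 1))⁻¹) t := by
    by_cases hk : Even k
    · have hk' : ¬ Even (k + 1) := by simpa [Nat.even_add_one] using hk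
      simp only [hr, hk, hk', if_true, if_false] at hdr hdr'
      exact ⟨hdr, hdr'⟩
    · have hk' : Even (k + 1) := by simpa [Nat.even_add_one] using hk
      simp only [hr, hk, hk', if_true, if_false] at hdr hdr'
      exact ⟨hdr', hdr⟩
  refine ⟨w * (p (k + 1))⁻¹, k + 1, by simp [hp], by simp only [hP] at h1; omega, hst.1, hst.2, ?_⟩
  by_contra hcon
  push Not at hcon
  obtain ⟨hm0, hmk⟩ := hcon
  obtain ⟨m, hm⟩ : ∃ m, M s t = m + 1 := ⟨M s t - 1, by omega⟩
  have hPm : P (m + 1) := hmin _ (by omega)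
  apply hs
  have hbraid : p (m + 1) = cs.wordProd (alternatingWord s t m) * cs.simple s := by
    rw [← cs.wordProd_concat, ← alternatingWord_succ, ← hm]
    have := cs.wordProd_braidWord_eq s t
    simp only [braidWord, M.symmetric t s] at this
    exact this
  have hws : w * cs.simple s = w * (p (m + 1))⁻¹ * cs.wordProd (alternatingWord s t m) := by
    have : w = w * (p (m + 1))⁻¹ * p (m + 1) := by group
    conv_lhs => rw [this, hbraid]
    rw [hbraid, mul_assoc, mul_assoc, cs.simple_mul_simple_cancel_right, mul_assoc]
  unfold IsRightDescent
  rw [hws]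
  have := cs.length_mul_le (w * (p (m + 1))⁻¹) (cs.wordProd (alternatingWord s t m))
  have := hlen m
  simp only [hP] at hPm
  simp only [hp] at *
  omega

end AlternatingFactor

section Representation

variable [Fintype B] {M : CoxeterMatrix B} (cs : CoxeterSystem M W)

/-- The geometric representation of a Coxeter group. -/
def rep : W →* Module.End ℝ (B → ℝ) := cs.lift ⟨_, simple_refl_isLiftable M⟩

lemma rep_simple (s : B) : rep cs (cs.simple s) = refl M (simpleRoot s) :=
  cs.lift_apply_simple (simple_refl_isLiftable M) s

lemma rep_simple_apply (s : B) (x : B → ℝ) :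
    rep cs (cs.simple s) x = x - (2 * bil M (simpleRoot s) x) • simpleRoot s := by
  rw [rep_simple, refl_apply]

lemma rep_mul_apply (g h : W) (x : B → ℝ) : rep cs (g * h) x = rep cs g (rep cs h x) := by
  rw [map_mul, Module.End.mul_apply]

lemma rep_one_apply (x : B → ℝ) : rep cs 1 x = x := by
  rw [map_one, Module.End.one_apply]

lemma rep_inv_rep (g : W) (x : B → ℝ) : rep cs g⁻¹ (rep cs g x) = x := by
  rw [← rep_mul_apply, inv_mul_cancel, rep_one_apply]

lemma rep_rep_inv (g : W) (x : B → ℝ) : rep cs g (rep cs g⁻¹ x) = x := by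
  rw [← rep_mul_apply, mul_inv_cancel, rep_one_apply]

lemma rep_injective (g : W) : Function.Injective (rep cs g) :=
  Function.LeftInverse.injective (rep_inv_rep cs g)

lemma bil_rep (g : W) (x y : B → ℝ) : bil M (rep cs g x) (rep cs g y) = bil M x y := by
  induction g using cs.simple_induction_left with
  | one => simp only [rep_one_apply]
  | mul_simple_left g s ih =>
    rw [rep_mul_apply, rep_mul_apply, rep_simple, bil_refl M (bil_simpleRoot_self M s), ih]

lemma bil_rep_right (g : W) (x y : B → ℝ) : bil M x (rep cs g y) = bil M (rep cs g⁻¹ x) y := by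
  rw [← bil_rep cs g (rep cs g⁻¹ x) y, rep_rep_inv]

open CoxeterSystem in
lemma rep_wordProd_alternatingWord (s t : B) (k : ℕ) :
    rep cs (cs.wordProd (alternatingWord s t k)) (simpleRoot s) =
      if Even k then cheb (-bil M (simpleRoot s) (simpleRoot t)) (k + 1) • simpleRoot s +
        cheb (-bil M (simpleRoot s) (simpleRoot t)) k • simpleRoot t
      else cheb (-bil M (simpleRoot s) (simpleRoot t)) k • simpleRoot s +
        cheb (-bil M (simpleRoot s) (simpleRoot t)) (k + 1) • simpleRoot t := by
  induction k with
  | zero => simp [alternatingWord, cheb]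
  | succ k ih =>
    rw [alternatingWord_succ', cs.wordProd_cons, rep_mul_apply, ih]
    have hs := bil_simpleRoot_self M s
    have ht := bil_simpleRoot_self M t
    by_cases hk : Even k
    · have hk' : ¬ Even (k + 1) := by simpa [Nat.even_add_one] using hk
      simp only [hk, hk', if_true, if_false, rep_simple_apply, map_add, map_smul,
        ht, bil_symm M (simpleRoot t) (simpleRoot s), cheb]
      module
    · have hk' : Even (k + 1) := by simpa [Nat.even_add_one] using hk
      simp only [hk, hk', if_true, if_false, rep_simple_apply, map_add, map_smul,
        hs, cheb]
      module

lemma cheb_neg_bil_nonneg {s t : B} (hst : s ≠ t) {k : ℕ} (hk : M s t = 0 ∨ k ≤ M s t) :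
    0 ≤ cheb (-bil M (simpleRoot s) (simpleRoot t)) k := by
  rw [bil_simpleRoot, formEntry]
  split_ifs with h0
  · rw [neg_neg, cheb_one]; positivity
  · rw [neg_neg]
    exact cheb_nonneg (two_le_of_ne M hst h0) (hk.resolve_left h0)

theorem rep_simpleRoot_nonneg (w : W) (s : B) (hs : ¬ cs.IsRightDescent w s) (b : B) :
    0 ≤ rep cs w (simpleRoot s) b := by
  induction hn : cs.length w using Nat.strong_induction_on generalizing w s b with
  | _ n ih =>
  by_cases h1 : w = 1
  · rw [h1, rep_one_apply]; exact simpleRoot_nonneg s b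
  obtain ⟨t, ht⟩ := cs.exists_rightDescent_of_ne_one h1
  have hst : s ≠ t := by rintro rfl; exact hs ht
  obtain ⟨v, k, hwv, hlt, hvs, hvt, hk⟩ := exists_alternating_factor cs w s t hs ht
  have es := ih _ (hn ▸ hlt) v s hvs b rfl
  have et := ih _ (hn ▸ hlt) v t hvt b rfl
  have c0 := cheb_neg_bil_nonneg hst (k := k) (hk.imp id (by omega))
  have c1 := cheb_neg_bil_nonneg hst (k := k + 1) hk
  rw [hwv, rep_mul_apply, rep_wordProd_alternatingWord]
  split_ifs
  all_goals
    simp only [map_add, map_smul, Pi.add_apply, Pi.smul_apply, smul_eq_mul]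
    positivity

lemma rep_simpleRoot_nonpos (w : W) (s : B) (hs : cs.IsRightDescent w s) (b : B) :
    rep cs w (simpleRoot s) b ≤ 0 := by
  have h := rep_simpleRoot_nonneg cs (w * cs.simple s) s
    ((cs.isRightDescent_iff_not_isRightDescent_mul).mp hs) b
  rw [rep_mul_apply, rep_simple_apply, bil_simpleRoot_self] at h
  have e : simpleRoot s - (2 * 1 : ℝ) • simpleRoot s = -simpleRoot s := by module
  rw [e, map_neg, Pi.neg_apply] at h
  linarith

end Representation

section CoordinateSubspaces

lemma not_nonneg_neg_simpleRoot (s : B) : ¬ (0 : B → ℝ) ≤ -simpleRoot s := fun h => by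
  have := h s
  simp only [Pi.zero_apply, Pi.neg_apply, simpleRoot_self] at this
  linarith

/-- The subspace of vectors supported on `J`. -/
def coordSpan (J : Set B) : Submodule ℝ (B → ℝ) where
  carrier := {v | ∀ s, s ∉ J → v s = 0}
  add_mem' ha hb s hs := by simp [ha s hs, hb s hs]
  zero_mem' := fun _ _ => rfl
  smul_mem' c x hx s hs := by simp [hx s hs]

lemma mem_coordSpan {J : Set B} {v : B → ℝ} : v ∈ coordSpan J ↔ ∀ s, s ∉ J → v s = 0 := Iff.rfl

lemma simpleRoot_mem_coordSpan {J : Set B} {s : B} : simpleRoot s ∈ coordSpan J ↔ s ∈ J := by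
  refine ⟨fun h => ?_, fun h t ht => simpleRoot_of_ne (by rintro rfl; exact ht h)⟩
  by_contra hs
  simpa [simpleRoot_self] using h s hs

end CoordinateSubspaces

section Roots

variable [Fintype B] {M : CoxeterMatrix B} (cs : CoxeterSystem M W)

/-- A root is a translate of a simple root. -/
def IsRoot (v : B → ℝ) : Prop := ∃ (g : W) (s : B), v = rep cs g (simpleRoot s)

/-- The sum of the coordinates with respect to the simple roots. -/
def ht : (B → ℝ) →ₗ[ℝ] ℝ := ∑ s, LinearMap.proj s

lemma ht_apply (v : B → ℝ) : ht v = ∑ s, v s := by simp [ht]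

lemma ht_nonneg {v : B → ℝ} (h : 0 ≤ v) : 0 ≤ ht v := by
  rw [ht_apply]; exact Finset.sum_nonneg fun s _ => h s

lemma ht_simpleRoot (s : B) : ht (simpleRoot s) = 1 := by
  classical
  simp [ht_apply, simpleRoot, Pi.single_apply]

lemma ht_pos {v : B → ℝ} (h : 0 ≤ v) (hv : v ≠ 0) : 0 < ht v := by
  refine (ht_nonneg h).lt_of_ne fun h0 => hv ?_
  rw [ht_apply, eq_comm, Finset.sum_eq_zero_iff_of_nonneg fun s _ => h s] at h0
  ext s
  exact h0 s (Finset.mem_univ s)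

variable {cs}

lemma isRoot_simpleRoot (s : B) : IsRoot cs (simpleRoot s) := ⟨1, s, (rep_one_apply cs _).symm⟩

lemma IsRoot.rep {v : B → ℝ} (h : IsRoot cs v) (g : W) : IsRoot cs (rep cs g v) := by
  obtain ⟨h, s, rfl⟩ := h
  exact ⟨g * h, s, (rep_mul_apply cs g h _).symm⟩

lemma IsRoot.bil_self {v : B → ℝ} (h : IsRoot cs v) : bil M v v = 1 := by
  obtain ⟨h, s, rfl⟩ := h
  rw [bil_rep, bil_simpleRoot_self]

lemma IsRoot.ne_zero {v : B → ℝ} (h : IsRoot cs v) : v ≠ 0 := by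
  rintro rfl
  simpa using h.bil_self

lemma rep_simple_simpleRoot (s : B) : rep cs (cs.simple s) (simpleRoot s) = -simpleRoot s := by
  rw [rep_simple_apply, bil_simpleRoot_self]; module

lemma rep_simple_rep_simple (s : B) (v : B → ℝ) :
    rep cs (cs.simple s) (rep cs (cs.simple s) v) = v := by
  rw [← rep_mul_apply, cs.simple_mul_simple_self, rep_one_apply]

lemma IsRoot.neg {v : B → ℝ} (h : IsRoot cs v) : IsRoot cs (-v) := by
  obtain ⟨g, s, rfl⟩ := h
  exact ⟨g * cs.simple s, s, by rw [rep_mul_apply, rep_simple_simpleRoot, map_neg]⟩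

lemma IsRoot.nonneg_or_nonpos {v : B → ℝ} (h : IsRoot cs v) : 0 ≤ v ∨ v ≤ 0 := by
  obtain ⟨g, s, rfl⟩ := h
  by_cases hd : cs.IsRightDescent g s
  · exact Or.inr fun b => rep_simpleRoot_nonpos cs g s hd b
  · exact Or.inl fun b => rep_simpleRoot_nonneg cs g s hd b

lemma IsRoot.nonpos {v : B → ℝ} (h : IsRoot cs v) (hv : ¬ 0 ≤ v) : v ≤ 0 :=
  h.nonneg_or_nonpos.resolve_left hv

lemma IsRoot.not_nonneg {v : B → ℝ} (h : IsRoot cs v) (hv : v ≤ 0) : ¬ 0 ≤ v :=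
  fun h' => h.ne_zero (le_antisymm hv h')

lemma IsRoot.neg_nonneg_iff {v : B → ℝ} (h : IsRoot cs v) : 0 ≤ -v ↔ ¬ 0 ≤ v :=
  ⟨fun hv => h.not_nonneg (neg_nonneg.mp hv), fun hv => neg_nonneg.mpr (h.nonpos hv)⟩

lemma IsRoot.ht_pos {v : B → ℝ} (h : IsRoot cs v) (hv : 0 ≤ v) : 0 < ht v :=
  CoxeterPaper.ht_pos hv h.ne_zero

lemma IsRoot.rep_simple_nonneg {v : B → ℝ} (h : IsRoot cs v) (hv : 0 ≤ v) {s : B}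
    (hs : v ≠ simpleRoot s) : 0 ≤ CoxeterPaper.rep cs (cs.simple s) v := by
  by_contra hcon
  have hneg := (h.rep (cs.simple s)).nonpos hcon
  have hvt : ∀ t, t ≠ s → v t = 0 := by
    intro t ht
    have := hneg t
    rw [rep_simple_apply] at this
    simp only [Pi.sub_apply, Pi.smul_apply, simpleRoot_of_ne ht, smul_zero, sub_zero,
      Pi.zero_apply] at this
    exact le_antisymm this (hv t)
  have hvs : v = v s • simpleRoot s := by
    ext t
    by_cases ht : t = s
    · subst ht; simp [simpleRoot_self]
    · simp [simpleRoot_of_ne ht, hvt t ht]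
  have h1 := h.bil_self
  rw [hvs] at h1
  simp only [map_smul, LinearMap.smul_apply, bil_simpleRoot_self, smul_eq_mul, mul_one] at h1
  have h0 : 0 ≤ v s := hv s
  have : v s = 1 := by nlinarith
  rw [this, one_smul] at hvs
  exact hs hvs

variable (cs) in
/-- The positive roots made negative by `g`. -/
def Inv (g : W) : Set (B → ℝ) := {v | IsRoot cs v ∧ 0 ≤ v ∧ ¬ 0 ≤ rep cs g v}

variable (cs) in
lemma inv_finite (g : W) : (Inv cs g).Finite := by
  induction g using cs.simple_induction_right with
  | one =>
    refine Set.finite_empty.subset fun v hv => ?_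
    exact hv.2.2 (by rw [rep_one_apply]; exact hv.2.1)
  | mul_simple_right g s ih =>
    refine ((ih.image (rep cs (cs.simple s))).union (Set.finite_singleton (simpleRoot s))).subset
      fun v hv => ?_
    by_cases hs : v = simpleRoot s
    · exact Or.inr hs
    · refine Or.inl ⟨rep cs (cs.simple s) v, ⟨hv.1.rep _, hv.1.rep_simple_nonneg hv.2.1 hs, ?_⟩,
        rep_simple_rep_simple s v⟩
      rw [← rep_mul_apply]; exact hv.2.2

lemma isRightDescent_of_not_nonneg {g : W} {s : B} (h : ¬ 0 ≤ rep cs g (simpleRoot s)) :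
    cs.IsRightDescent g s := by
  by_contra hd
  exact h fun b => rep_simpleRoot_nonneg cs g s hd b

lemma exists_not_nonneg {g : W} (hg : g ≠ 1) : ∃ s, ¬ 0 ≤ rep cs g (simpleRoot s) := by
  obtain ⟨s, hs⟩ := cs.exists_rightDescent_of_ne_one hg
  exact ⟨s, ((isRoot_simpleRoot s).rep g).not_nonneg fun b => rep_simpleRoot_nonpos cs g s hs b⟩

lemma length_le_ncard_inv (g : W) : cs.length g ≤ (Inv cs g).ncard := by
  induction hn : cs.length g generalizing g with
  | zero => exact Nat.zero_le _
  | succ n ih =>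
    have hg : g ≠ 1 := by rintro rfl; simp at hn
    obtain ⟨s, hs⟩ := exists_not_nonneg (cs := cs) hg
    have hd := cs.isRightDescent_iff.mp (isRightDescent_of_not_nonneg hs)
    have h1 := ih (g * cs.simple s) (by omega)
    have hsub : insert (simpleRoot s) (rep cs (cs.simple s) '' Inv cs (g * cs.simple s)) ⊆
        Inv cs g := by
      rintro v (rfl | ⟨u, hu, rfl⟩)
      · exact ⟨isRoot_simpleRoot s, simpleRoot_nonneg s, hs⟩
      · refine ⟨hu.1.rep _, hu.1.rep_simple_nonneg hu.2.1 ?_, ?_⟩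
        · rintro rfl
          have h3 := hu.2.2
          rw [rep_mul_apply, rep_simple_simpleRoot, map_neg,
            ((isRoot_simpleRoot s).rep g).neg_nonneg_iff, not_not] at h3
          exact hs h3
        · rw [← rep_mul_apply]; exact hu.2.2
    have hnot : simpleRoot s ∉ rep cs (cs.simple s) '' Inv cs (g * cs.simple s) := by
      rintro ⟨u, hu, hus⟩
      have : u = -simpleRoot s := by
        rw [← rep_simple_simpleRoot (cs := cs), ← hus, rep_simple_rep_simple]
      rw [this] at hu
      exact not_nonneg_neg_simpleRoot s hu.2.1
    have h2 := Set.ncard_le_ncard hsub (inv_finite cs g)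
    rw [Set.ncard_insert_of_notMem hnot ((inv_finite cs _).image _),
      Set.ncard_image_of_injective _ (rep_injective cs _)] at h2
    omega

variable (cs) in
lemma finite_length_le (n : ℕ) : {g : W | cs.length g ≤ n}.Finite := by
  refine ((List.finite_length_le B n).image cs.wordProd).subset fun g hg => ?_
  obtain ⟨ω, hω, rfl⟩ := cs.exists_isReduced g
  exact ⟨ω, by rw [Set.mem_ofPred_eq, ← hω.eq]; exact hg, rfl⟩

variable (cs) in
lemma finite_ncard_inv_le (n : ℕ) : {g : W | (Inv cs g).ncard ≤ n}.Finite :=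
  (finite_length_le cs n).subset fun g hg => (length_le_ncard_inv g).trans hg

lemma finite_inv_subset {F : Set (B → ℝ)} (hF : F.Finite) : {g : W | Inv cs g ⊆ F}.Finite :=
  (finite_ncard_inv_le cs F.ncard).subset fun _ hg => Set.ncard_le_ncard hg hF

variable (cs) in
lemma infinite_roots [Infinite W] : {v | IsRoot cs v ∧ 0 ≤ v}.Infinite := fun h =>
  Set.infinite_univ ((finite_inv_subset (cs := cs) h).subset
    fun _ _ _ hv => ⟨hv.1, hv.2.1⟩)

lemma IsRoot.exists_reflection {a : B → ℝ} (h : IsRoot cs a) :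
    ∃ r : W, CoxeterPaper.rep cs r = refl M a := by
  obtain ⟨g, s, rfl⟩ := h
  refine ⟨g * cs.simple s * g⁻¹, LinearMap.ext fun x => ?_⟩
  rw [rep_mul_apply, rep_mul_apply, rep_simple_apply, refl_apply, map_sub, map_smul, rep_rep_inv,
    bil_rep_right]
  simp

lemma eq_sum_of_linear (f : (B → ℝ) →ₗ[ℝ] ℝ) (v : B → ℝ) : f v = ∑ s, v s * f (simpleRoot s) := by
  conv_lhs => rw [← sum_smul_simpleRoot v]
  simp

lemma apply_eq_zero_iff_mem_coordSpan {f : (B → ℝ) →ₗ[ℝ] ℝ} (hf : ∀ s, 0 ≤ f (simpleRoot s))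
    {v : B → ℝ} (hv : IsRoot cs v) : f v = 0 ↔ v ∈ coordSpan {s | f (simpleRoot s) = 0} := by
  have key : ∀ u : B → ℝ, 0 ≤ u → f u = 0 → u ∈ coordSpan {s | f (simpleRoot s) = 0} := by
    intro u hu h0 s hs
    rw [eq_sum_of_linear, Finset.sum_eq_zero_iff_of_nonneg
      fun s _ => mul_nonneg (hu s) (hf s)] at h0
    exact (mul_eq_zero.mp (h0 s (Finset.mem_univ s))).resolve_right hs
  constructor
  · intro h0
    rcases hv.nonneg_or_nonpos with h | h
    · exact key v h h0
    · rw [← neg_mem_iff]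
      exact key (-v) (neg_nonneg.mpr h) (by rw [map_neg, h0, neg_zero])
  · intro h
    rw [eq_sum_of_linear]
    refine Finset.sum_eq_zero fun s _ => ?_
    by_cases hs : f (simpleRoot s) = 0
    · rw [hs, mul_zero]
    · rw [h s hs, zero_mul]

variable (cs) in
/-- The positive roots on which a linear functional is negative. -/
def negSet (f : (B → ℝ) →ₗ[ℝ] ℝ) : Set (B → ℝ) := {v | IsRoot cs v ∧ 0 ≤ v ∧ f v < 0}

lemma exists_dominant {f : (B → ℝ) →ₗ[ℝ] ℝ} (hf : (negSet cs f).Finite) :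
    ∃ u : W, ∀ s, 0 ≤ f (rep cs u (simpleRoot s)) := by
  induction hn : (negSet cs f).ncard using Nat.strong_induction_on generalizing f with
  | _ n ih =>
  by_cases hdom : ∀ s, 0 ≤ f (simpleRoot s)
  · exact ⟨1, fun s => by rw [rep_one_apply]; exact hdom s⟩
  push Not at hdom
  obtain ⟨s, hs⟩ := hdom
  have hmem : simpleRoot s ∈ negSet cs f := ⟨isRoot_simpleRoot s, simpleRoot_nonneg s, hs⟩
  have hsub : negSet cs (f ∘ₗ rep cs (cs.simple s)) ⊆
      rep cs (cs.simple s) '' (negSet cs f \ {simpleRoot s}) := by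
    rintro v ⟨hv, hv0, hfv⟩
    rw [LinearMap.comp_apply] at hfv
    refine ⟨_, ⟨⟨hv.rep _, hv.rep_simple_nonneg hv0 ?_, hfv⟩, ?_⟩, rep_simple_rep_simple s v⟩
    · rintro rfl
      rw [rep_simple_simpleRoot, map_neg] at hfv
      linarith
    · intro h
      have : v = -simpleRoot s := by
        rw [← rep_simple_simpleRoot (cs := cs), ← Set.mem_singleton_iff.mp h,
          rep_simple_rep_simple]
      rw [this] at hv0
      exact not_nonneg_neg_simpleRoot s hv0
  have hfin : (rep cs (cs.simple s) '' (negSet cs f \ {simpleRoot s})).Finite :=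
    (hf.subset Set.sdiff_subset).image _
  have hlt : (negSet cs (f ∘ₗ rep cs (cs.simple s))).ncard < n := by
    calc _ ≤ _ := Set.ncard_le_ncard hsub hfin
      _ = (negSet cs f \ {simpleRoot s}).ncard :=
        Set.ncard_image_of_injective _ (rep_injective cs _)
      _ < (negSet cs f).ncard := Set.ncard_sdiff_singleton_lt_of_mem hmem hf
      _ = n := hn
  obtain ⟨u, hu⟩ := ih _ hlt (hfin.subset hsub) rfl
  exact ⟨cs.simple s * u, fun t => by rw [rep_mul_apply]; exact hu t⟩

end Roots

section FiniteCrossing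

variable [Fintype B] {M : CoxeterMatrix B} {cs : CoxeterSystem M W}

lemma exists_recurrence_nonpos {a b : B → ℝ} (n : ℕ) (σ : W) (c : ℝ) (hc1 : c < 1)
    (hn : 1 ≤ 2 ^ n * (1 - c))
    (ha : rep cs (σ * σ) a = (2 * c) • rep cs σ a - a)
    (hb : rep cs (σ * σ) b = (2 * c) • rep cs σ b - b) :
    ∃ (σ : W) (c : ℝ), c ≤ 0 ∧ rep cs (σ * σ) a = (2 * c) • rep cs σ a - a ∧
      rep cs (σ * σ) b = (2 * c) • rep cs σ b - b := by
  induction n generalizing σ c with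
  | zero => exact ⟨σ, c, by linarith, ha, hb⟩
  | succ n ih =>
    by_cases hc : c ≤ 0
    · exact ⟨σ, c, hc, ha, hb⟩
    push Not at hc
    have key : ∀ x, rep cs (σ * σ) x = (2 * c) • rep cs σ x - x →
        rep cs (σ * σ * (σ * σ)) x = (2 * (2 * c ^ 2 - 1)) • rep cs (σ * σ) x - x := by
      intro x hx
      rw [rep_mul_apply] at hx
      simp only [rep_mul_apply, hx, map_sub, map_smul]
      module
    refine ih (σ * σ) (2 * c ^ 2 - 1) (by nlinarith) ?_ (key a ha) (key b hb)
    have h2 : (0 : ℝ) < 2 ^ n := by positivity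
    rw [pow_succ] at hn
    have : 2 * (1 - c) ≤ 1 - (2 * c ^ 2 - 1) := by nlinarith
    nlinarith

lemma exists_recurrence {a b : B → ℝ} (ha : IsRoot cs a) (hb : IsRoot cs b)
    (hab : |bil M a b| < 1) :
    ∃ (σ : W) (c : ℝ), c ≤ 0 ∧ rep cs (σ * σ) a = (2 * c) • rep cs σ a - a ∧
      rep cs (σ * σ) b = (2 * c) • rep cs σ b - b := by
  obtain ⟨r, hr⟩ := ha.exists_reflection
  obtain ⟨q, hq⟩ := hb.exists_reflection
  have h1 : 2 * bil M a b ^ 2 - 1 < 1 := by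
    have := (sq_lt_one_iff_abs_lt_one _).mpr hab
    linarith
  obtain ⟨n, hn⟩ := pow_unbounded_of_one_lt (1 / (1 - (2 * bil M a b ^ 2 - 1))) one_lt_two
  rw [div_lt_iff₀ (by linarith)] at hn
  refine exists_recurrence_nonpos n (r * q) _ h1 hn.le ?_ ?_
  all_goals
    simp only [rep_mul_apply, hr, hq, refl_apply, map_sub, map_smul, ha.bil_self, hb.bil_self,
      bil_symm M b a]
    module

lemma exists_finite_parabolic {a b : B → ℝ} (ha : IsRoot cs a) (hb : IsRoot cs b)
    (hab : |bil M a b| < 1) :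
    ∃ (J : Set B) (u : W), {v | IsRoot cs v ∧ v ∈ coordSpan J}.Finite ∧
      rep cs u a ∈ coordSpan J ∧ rep cs u b ∈ coordSpan J := by
  obtain ⟨σ, c, hc, hσa, hσb⟩ := exists_recurrence ha hb hab
  set f : (B → ℝ) →ₗ[ℝ] ℝ :=
    ht ∘ₗ (rep cs (σ * σ) - (2 * c) • rep cs σ + LinearMap.id) with hf
  have fa : ∀ v, f v = ht (rep cs (σ * σ) v) - 2 * c * ht (rep cs σ v) + ht v := by
    intro v; simp [hf]
  have f0 : ∀ x, rep cs (σ * σ) x = (2 * c) • rep cs σ x - x → f x = 0 := by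
    intro x hx
    rw [fa, hx]; simp
  set D : Set (B → ℝ) := {v | IsRoot cs v ∧ 0 ≤ v ∧ f v ≤ 0} with hDdef
  have hD : D.Finite := by
    refine ((inv_finite cs σ).union (inv_finite cs (σ * σ))).subset fun v hv => ?_
    obtain ⟨hv, hv0, hfv⟩ := hv
    by_contra hcon
    simp only [Set.mem_union, not_or] at hcon
    have h1 : 0 ≤ rep cs σ v := by
      by_contra h; exact hcon.1 ⟨hv, hv0, h⟩
    have h2 : 0 ≤ rep cs (σ * σ) v := by
      by_contra h; exact hcon.2 ⟨hv, hv0, h⟩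
    rw [fa] at hfv
    have := hv.ht_pos hv0
    have := ht_nonneg h1
    have := ht_nonneg h2
    nlinarith
  obtain ⟨u, hu⟩ := exists_dominant (cs := cs) (f := f)
    (hD.subset fun v hv => ⟨hv.1, hv.2.1, hv.2.2.le⟩)
  have hdom : ∀ s, 0 ≤ (f ∘ₗ rep cs u) (simpleRoot s) := hu
  refine ⟨{s | (f ∘ₗ rep cs u) (simpleRoot s) = 0}, u⁻¹, ?_, ?_, ?_⟩
  · refine ((hD.union (hD.image Neg.neg)).image (rep cs u⁻¹)).subset fun v hv => ?_
    obtain ⟨hv, hvJ⟩ := hv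
    have h0 : f (rep cs u v) = 0 := (apply_eq_zero_iff_mem_coordSpan hdom hv).mpr hvJ
    refine ⟨rep cs u v, ?_, rep_inv_rep cs u v⟩
    rcases (hv.rep u).nonneg_or_nonpos with h | h
    · exact Or.inl ⟨hv.rep u, h, h0.le⟩
    · exact Or.inr ⟨-rep cs u v, ⟨(hv.rep u).neg, neg_nonneg.mpr h, by rw [map_neg, h0]; simp⟩,
        neg_neg _⟩
  · rw [← apply_eq_zero_iff_mem_coordSpan hdom (ha.rep _), LinearMap.comp_apply, rep_rep_inv]
    exact f0 a hσa
  · rw [← apply_eq_zero_iff_mem_coordSpan hdom (hb.rep _), LinearMap.comp_apply, rep_rep_inv]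
    exact f0 b hσb

variable (cs) in
/-- The values in `(-1, 1)` taken by the form on pairs of roots. -/
def crossingValues : Set ℝ :=
  {c | |c| < 1 ∧ ∃ a b, IsRoot cs a ∧ IsRoot cs b ∧ bil M a b = c}

variable (cs) in
lemma finite_crossingValues : (crossingValues cs).Finite := by
  set R : Set B → Set (B → ℝ) := fun J => {v | IsRoot cs v ∧ v ∈ coordSpan J} with hR
  have hfin : (⋃ J ∈ {J | (R J).Finite}, Set.image2 (fun a b => bil M a b) (R J) (R J)).Finite :=
    (Set.toFinite _).biUnion fun J hJ => Set.Finite.image2 _ hJ hJ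
  refine hfin.subset ?_
  rintro _ ⟨hlt, a, b, ha, hb, rfl⟩
  obtain ⟨J, u, hJ, hua, hub⟩ := exists_finite_parabolic ha hb hlt
  refine Set.mem_biUnion (x := J) hJ ⟨_, ⟨ha.rep u, hua⟩, _, ⟨hb.rep u, hub⟩, bil_rep cs u a b⟩

variable (cs) in
lemma exists_bil_gap : ∃ ε : ℝ, 0 < ε ∧ ∀ a b, IsRoot cs a → IsRoot cs b → 0 < bil M a b →
    ε ≤ bil M a b := by
  classical
  have hfin : (insert 1 (crossingValues cs ∩ {c | 0 < c})).Finite :=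
    ((finite_crossingValues cs).inter_of_left _).insert 1
  obtain ⟨ε, hε, hmin⟩ := Set.exists_min_image _ id hfin (Set.insert_nonempty _ _)
  refine ⟨ε, ?_, fun a b ha hb hab => ?_⟩
  · rcases hε with rfl | hε
    · exact one_pos
    · exact hε.2
  · by_cases h1 : bil M a b < 1
    · exact hmin _ (Or.inr ⟨⟨by rw [abs_lt]; constructor <;> linarith, a, b, ha, hb, rfl⟩, hab⟩)
    · exact (hmin 1 (Or.inl rfl)).trans (not_lt.mp h1)

end FiniteCrossing

section Heights

variable [Fintype B] {M : CoxeterMatrix B} {cs : CoxeterSystem M W}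

lemma bil_eq_sum (x v : B → ℝ) : bil M x v = ∑ s, v s * bil M x (simpleRoot s) :=
  eq_sum_of_linear (bil M x) v

lemma IsRoot.exists_bil_pos {v : B → ℝ} (hv : IsRoot cs v) (h0 : 0 ≤ v) :
    ∃ s, 0 < v s ∧ 0 < bil M v (simpleRoot s) := by
  by_contra! hcon
  have h1 := hv.bil_self
  rw [bil_eq_sum] at h1
  have : ∑ s, v s * bil M v (simpleRoot s) ≤ 0 := Finset.sum_nonpos fun s _ => by
    rcases (h0 s).eq_or_lt with h | h
    · rw [← h]; simp
    · exact mul_nonpos_of_nonneg_of_nonpos h.le (hcon s h)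
  linarith

lemma ht_rep_simple (s : B) (v : B → ℝ) :
    ht (rep cs (cs.simple s) v) = ht v - 2 * bil M v (simpleRoot s) := by
  rw [rep_simple_apply, map_sub, map_smul, ht_simpleRoot, bil_symm]; simp

lemma rep_simple_mem_coordSpan {J : Set B} {s : B} (hs : s ∈ J) {v : B → ℝ}
    (hv : v ∈ coordSpan J) : rep cs (cs.simple s) v ∈ coordSpan J := by
  rw [rep_simple_apply]
  exact sub_mem hv (Submodule.smul_mem _ _ (simpleRoot_mem_coordSpan.mpr hs))

variable (cs) in
lemma exists_descent_step : ∃ ε : ℝ, 0 < ε ∧ ∀ v, IsRoot cs v → 0 ≤ v → ∀ J : Set B,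
    v ∈ coordSpan J → (∃ t ∈ J, v = simpleRoot t) ∨
      ∃ s ∈ J, ∃ v', IsRoot cs v' ∧ 0 ≤ v' ∧ v' ∈ coordSpan J ∧ v = rep cs (cs.simple s) v' ∧
        ht v' ≤ ht v - ε := by
  obtain ⟨ε, hε, hgap⟩ := exists_bil_gap cs
  refine ⟨2 * ε, by positivity, fun v hv h0 J hJ => ?_⟩
  obtain ⟨s, hvs, hs⟩ := hv.exists_bil_pos h0
  have hsJ : s ∈ J := by
    by_contra h
    exact hvs.ne' (hJ s h)
  by_cases hsimple : v = simpleRoot s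
  · exact Or.inl ⟨s, hsJ, hsimple⟩
  refine Or.inr ⟨s, hsJ, rep cs (cs.simple s) v, hv.rep _, hv.rep_simple_nonneg h0 hsimple,
    rep_simple_mem_coordSpan hsJ hJ, (rep_simple_rep_simple s v).symm, ?_⟩
  rw [ht_rep_simple]
  have := hgap v _ hv (isRoot_simpleRoot s) hs
  linarith

variable (cs) in
lemma finite_ht_le (H : ℝ) : {v | IsRoot cs v ∧ 0 ≤ v ∧ ht v ≤ H}.Finite := by
  obtain ⟨ε, hε, hstep⟩ := exists_descent_step cs
  have key : ∀ n : ℕ, {v | IsRoot cs v ∧ 0 ≤ v ∧ ht v ≤ n * ε}.Finite := by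
    intro n
    induction n with
    | zero =>
      refine Set.finite_empty.subset fun v hv => ?_
      obtain ⟨hv, h0, hle⟩ := hv
      have := hv.ht_pos h0
      simp only [Nat.cast_zero, zero_mul] at hle
      linarith
    | succ n ih =>
      refine ((Set.finite_range simpleRoot).union
        (Set.finite_iUnion fun s : B => ih.image (rep cs (cs.simple s)))).subset fun v hv => ?_
      obtain ⟨hv, h0, hle⟩ := hv
      rcases hstep v hv h0 Set.univ (fun s hs => absurd (Set.mem_univ s) hs) with
        ⟨t, _, rfl⟩ | ⟨s, _, v', hv', h0', _, rfl, hle'⟩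
      · exact Or.inl ⟨t, rfl⟩
      · refine Or.inr (Set.mem_iUnion.mpr ⟨s, v', ⟨hv', h0', ?_⟩, rfl⟩)
        push_cast at hle
        linarith
  obtain ⟨n, hn⟩ := exists_nat_gt (H / ε)
  rw [div_lt_iff₀ hε] at hn
  exact (key n).subset fun v hv => ⟨hv.1, hv.2.1, hv.2.2.trans hn.le⟩

lemma IsRoot.induction_coordSpan {J : Set B} {p : (B → ℝ) → Prop}
    (simple : ∀ t ∈ J, p (simpleRoot t))
    (step : ∀ v, ∀ s ∈ J, IsRoot cs v → v ∈ coordSpan J → p v →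
      p (CoxeterPaper.rep cs (cs.simple s) v))
    {v : B → ℝ} (hv : IsRoot cs v) (h0 : 0 ≤ v) (hJ : v ∈ coordSpan J) : p v := by
  obtain ⟨ε, hε, hstep⟩ := exists_descent_step cs
  have key : ∀ n : ℕ, ∀ v, IsRoot cs v → 0 ≤ v → v ∈ coordSpan J → ht v ≤ n * ε → p v := by
    intro n
    induction n with
    | zero =>
      intro v hv h0 _ hle
      have := hv.ht_pos h0
      simp only [Nat.cast_zero, zero_mul] at hle
      linarith
    | succ n ih =>
      intro v hv h0 hJ hle
      rcases hstep v hv h0 J hJ with ⟨t, ht, rfl⟩ | ⟨s, hs, v', hv', h0', hJ', rfl, hle'⟩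
      · exact simple t ht
      · refine step v' s hs hv' hJ' (ih v' hv' h0' hJ' ?_)
        push_cast at hle
        linarith
  obtain ⟨n, hn⟩ := exists_nat_gt (ht v / ε)
  rw [div_lt_iff₀ hε] at hn
  exact key n v hv h0 hJ hn.le

end Heights

section Nested

variable [Fintype B] {M : CoxeterMatrix B} {cs : CoxeterSystem M W}

lemma cheb_add_one_le {c : ℝ} (hc : 1 ≤ c) (n : ℕ) :
    0 ≤ cheb c n ∧ cheb c n + 1 ≤ cheb c (n + 1) := by
  induction n with
  | zero => simp [cheb]
  | succ n ih =>
    obtain ⟨h0, h1⟩ := ih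
    refine ⟨by linarith, ?_⟩
    rw [cheb]
    nlinarith

/-- Two roots whose product is at most `-1` span half-spaces whose complements are disjoint, as soon
as the half-spaces meet. -/
lemma IsRoot.nonneg_or_nonneg_of_bil_le {a b : B → ℝ} (ha : IsRoot cs a) (hb : IsRoot cs b)
    (hab : bil M a b ≤ -1) {x : W} (hxa : 0 ≤ CoxeterPaper.rep cs x a)
    (hxb : 0 ≤ CoxeterPaper.rep cs x b) (y : W) :
    0 ≤ CoxeterPaper.rep cs y a ∨ 0 ≤ CoxeterPaper.rep cs y b := by
  by_contra! hcon
  obtain ⟨hya, hyb⟩ := hcon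
  obtain ⟨r, hr⟩ := ha.exists_reflection
  obtain ⟨q, hq⟩ := hb.exists_reflection
  have hc : 1 ≤ -bil M a b := by linarith
  set U := cheb (-bil M a b) with hU
  have hγ : ∀ n : ℕ, CoxeterPaper.rep cs ((r * q) ^ n) a = U (2 * n + 1) • a + U (2 * n) • b := by
    intro n
    rw [map_pow, map_mul, hr, hq, refl_mul_refl_pow_apply M ha.bil_self hb.bil_self]
  have hU0 : ∀ n, 0 ≤ U n := fun n => (cheb_add_one_le hc n).1
  have hU1 : ∀ n, 1 ≤ U (n + 1) := fun n => by linarith [(cheb_add_one_le hc n).2, hU0 n]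
  have hUm : StrictMono U := strictMono_nat_of_lt_succ fun n => by
    linarith [(cheb_add_one_le hc n).2]
  set γ : ℕ → B → ℝ := fun n => CoxeterPaper.rep cs x (U (2 * n + 1) • a + U (2 * n) • b) with hγdef
  have hγroot : ∀ n, IsRoot cs (γ n) := fun n => by
    simp only [hγdef]; rw [← hγ]; exact (ha.rep _).rep _
  have hmem : ∀ n, γ n ∈ Inv cs (y * x⁻¹) := by
    intro n
    refine ⟨hγroot n, ?_, ?_⟩
    · simp only [hγdef, map_add, map_smul]
      exact add_nonneg (smul_nonneg (hU0 _) hxa) (smul_nonneg (hU0 _) hxb)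
    · apply ((hγroot n).rep _).not_nonneg
      simp only [hγdef]
      rw [← rep_mul_apply, inv_mul_cancel_right, map_add, map_smul, map_smul]
      exact add_nonpos (smul_nonpos_of_nonneg_of_nonpos (hU0 _) ((ha.rep y).nonpos hya))
        (smul_nonpos_of_nonneg_of_nonpos (hU0 _) ((hb.rep y).nonpos hyb))
  have hmono : StrictMono fun n => ht (γ n) := by
    refine strictMono_nat_of_lt_succ fun n => ?_
    simp only [hγdef, map_add, map_smul, smul_eq_mul]
    have h1 : U (2 * n + 1) < U (2 * (n + 1) + 1) := hUm (by omega)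
    have h2 : U (2 * n) < U (2 * (n + 1)) := hUm (by omega)
    have h3 := (ha.rep x).ht_pos hxa
    have h4 := (hb.rep x).ht_pos hxb
    nlinarith
  have hinj : Function.Injective γ := fun m n h => hmono.injective (by simp only [h])
  exact Set.infinite_of_injective_forall_mem hinj hmem (inv_finite cs _)

end Nested

section Parabolic

variable [Fintype B] {M : CoxeterMatrix B} {cs : CoxeterSystem M W}

lemma rep_sub_mem_coordSpan {X : Set B} {g : W} (hg : g ∈ standardParabolic cs X) (v : B → ℝ) :
    rep cs g v - v ∈ coordSpan X := by
  induction hg using Subgroup.closure_induction generalizing v with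
  | mem g hg =>
    obtain ⟨s, hs, rfl⟩ := hg
    rw [rep_simple_apply, sub_sub_cancel_left, neg_mem_iff]
    exact Submodule.smul_mem _ _ (simpleRoot_mem_coordSpan.mpr hs)
  | one => rw [rep_one_apply, sub_self]; exact zero_mem _
  | mul g h _ _ ihg ihh =>
    have := add_mem (ihg (rep cs h v)) (ihh v)
    rwa [sub_add_sub_cancel, ← rep_mul_apply] at this
  | inv g _ ih =>
    have := ih (rep cs g⁻¹ v)
    rw [rep_rep_inv] at this
    rwa [← neg_mem_iff, neg_sub]

lemma eq_univ_of_standardParabolic_eq_top {X : Set B} (h : standardParabolic cs X = ⊤) :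
    X = Set.univ := by
  refine Set.eq_univ_of_forall fun s => ?_
  have := rep_sub_mem_coordSpan (cs := cs) (X := X) (g := cs.simple s) (h ▸ Subgroup.mem_top _)
    (simpleRoot s)
  rw [rep_simple_simpleRoot] at this
  have e : -simpleRoot s - simpleRoot s = (-2 : ℝ) • simpleRoot s := by module
  rw [e, Submodule.smul_mem_iff _ (by norm_num)] at this
  exact simpleRoot_mem_coordSpan.mp this

lemma IsEssential.eq_univ {w : W} (hw : IsEssential cs w) {u : W} {X : Set B}
    (h : u * w * u⁻¹ ∈ standardParabolic cs X) : X = Set.univ := by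
  by_contra hX
  refine hw _ ⟨u⁻¹, X, rfl⟩ (fun htop => hX (eq_univ_of_standardParabolic_eq_top (cs := cs) ?_))
    ⟨_, h, by simp [mul_assoc]⟩
  refine Subgroup.map_injective (f := (MulAut.conj u⁻¹).toMonoidHom) (MulAut.conj u⁻¹).injective
    (htop.trans ?_)
  exact (Subgroup.map_top_of_surjective _ (MulAut.conj u⁻¹).surjective).symm

lemma mem_standardParabolic_of_fix {f : (B → ℝ) →ₗ[ℝ] ℝ} (hf : ∀ s, 0 ≤ f (simpleRoot s))
    {g : W} (hg : ∀ x, f (rep cs g x) = f x) :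
    g ∈ standardParabolic cs {s | f (simpleRoot s) = 0} := by
  induction hn : cs.length g using Nat.strong_induction_on generalizing g with
  | _ n ih =>
  by_cases h1 : g = 1
  · rw [h1]; exact one_mem _
  obtain ⟨s, hs⟩ := exists_not_nonneg (cs := cs) h1
  have hle := ((isRoot_simpleRoot s).rep g).nonpos hs
  have h0 : f (simpleRoot s) = 0 := by
    refine le_antisymm ?_ (hf s)
    rw [← hg, eq_sum_of_linear]
    exact Finset.sum_nonpos fun t _ => mul_nonpos_of_nonpos_of_nonneg (hle t) (hf t)
  have hlt := isRightDescent_of_not_nonneg hs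
  have hmem := ih _ (hn ▸ hlt) (g := g * cs.simple s) (fun x => by
    rw [rep_mul_apply, hg, rep_simple_apply, map_sub, map_smul, h0, smul_zero, sub_zero]) rfl
  have := mul_mem hmem (Subgroup.subset_closure (Set.mem_image_of_mem cs.simple h0) :
    cs.simple s ∈ standardParabolic cs {s | f (simpleRoot s) = 0})
  rwa [cs.simple_mul_simple_cancel_right] at this

lemma IsEssential.not_isOfFinOrder [Infinite W] {w : W} (hw : IsEssential cs w) :
    ¬ IsOfFinOrder w := by
  intro hfin
  set n := orderOf w with hn
  have hn0 : 0 < n := hfin.orderOf_pos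
  set f : (B → ℝ) →ₗ[ℝ] ℝ := ∑ i ∈ Finset.range n, ht ∘ₗ rep cs (w ^ i) with hf
  have fa : ∀ v, f v = ∑ i ∈ Finset.range n, ht (rep cs (w ^ i) v) := fun v => by simp [hf]
  have hinv : ∀ v, f (rep cs w v) = f v := by
    intro v
    rw [fa, fa]
    have h1 := Finset.sum_range_succ (fun i => ht (rep cs (w ^ i) v)) n
    have h2 := Finset.sum_range_succ' (fun i => ht (rep cs (w ^ i) v)) n
    have h3 : ∀ i, ht (rep cs (w ^ i) (rep cs w v)) = ht (rep cs (w ^ (i + 1)) v) := fun i => by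
      rw [← rep_mul_apply, pow_succ]
    simp only [h3]
    rw [hn, pow_orderOf_eq_one, ← hn] at h1
    rw [pow_zero] at h2
    linarith
  have hD : {v | IsRoot cs v ∧ 0 ≤ v ∧ f v ≤ 0}.Finite := by
    refine (Set.finite_iUnion fun i : Fin n => inv_finite cs (w ^ (i : ℕ))).subset fun v hv => ?_
    obtain ⟨hv, h0, hle⟩ := hv
    by_contra hcon
    have hpos : ∀ i ∈ Finset.range n, 0 ≤ rep cs (w ^ i) v := by
      intro i hi
      by_contra hneg
      exact hcon (Set.mem_iUnion.mpr ⟨⟨i, Finset.mem_range.mp hi⟩, hv, h0, hneg⟩)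
    have : 0 < f v := by
      rw [fa]
      exact Finset.sum_pos (fun i hi => (hv.rep _).ht_pos (hpos i hi))
        ⟨0, Finset.mem_range.mpr hn0⟩
    linarith
  obtain ⟨u, hu⟩ := exists_dominant (cs := cs) (f := f)
    (hD.subset fun v hv => ⟨hv.1, hv.2.1, hv.2.2.le⟩)
  have hmem := mem_standardParabolic_of_fix (cs := cs) (f := f ∘ₗ rep cs u) hu
    (g := u⁻¹ * w * u⁻¹⁻¹) (fun x => by
      simp only [LinearMap.comp_apply]
      rw [rep_mul_apply, rep_mul_apply, rep_rep_inv, hinv, inv_inv])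
  have huniv := hw.eq_univ hmem
  have hf0 : ∀ x, f x = 0 := by
    intro x
    have h1 : (f ∘ₗ rep cs u) (rep cs u⁻¹ x) = 0 := by
      rw [eq_sum_of_linear]
      refine Finset.sum_eq_zero fun s _ => ?_
      have : s ∈ {s | (f ∘ₗ rep cs u) (simpleRoot s) = 0} := huniv ▸ Set.mem_univ s
      rw [this, mul_zero]
    rwa [LinearMap.comp_apply, rep_rep_inv] at h1
  exact infinite_roots cs (hD.subset fun v hv => ⟨hv.1, hv.2, (hf0 v).le⟩)

end Parabolic

section OddRoot

variable [Fintype B] {M : CoxeterMatrix B} {cs : CoxeterSystem M W}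

lemma rep_zpow_eq_self {g : W} {v : B → ℝ} (h : rep cs g v = v) (m : ℤ) :
    rep cs (g ^ m) v = v := by
  have hnat : ∀ n : ℕ, rep cs (g ^ n) v = v := fun n => by
    rw [map_pow]; exact pow_apply_eq_self h n
  obtain ⟨n, rfl | rfl⟩ := m.eq_nat_or_neg
  · rw [zpow_natCast, hnat]
  · conv_lhs => rw [← hnat n]
    rw [zpow_neg, zpow_natCast, rep_inv_rep]

lemma rep_zpow_rep_zpow (w : W) (i j : ℤ) (v : B → ℝ) :
    rep cs (w ^ i) (rep cs (w ^ j) v) = rep cs (w ^ (i + j)) v := by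
  rw [zpow_add, rep_mul_apply]

lemma rep_zpow_sub_eq_self {w : W} {v : B → ℝ} {i j : ℤ}
    (h : rep cs (w ^ i) v = rep cs (w ^ j) v) : rep cs (w ^ (i - j)) v = v := by
  rw [sub_eq_neg_add, ← rep_zpow_rep_zpow, h, rep_zpow_rep_zpow, neg_add_cancel, zpow_zero,
    rep_one_apply]

lemma finite_orbit_of_not_injective {w : W} {v : B → ℝ}
    (h : ¬ Function.Injective fun k : ℤ => rep cs (w ^ k) v) :
    (Set.range fun k : ℤ => rep cs (w ^ k) v).Finite := by
  simp only [Function.Injective, not_forall] at h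
  obtain ⟨i, j, hij, hne⟩ := h
  have hp := rep_zpow_sub_eq_self hij
  have hp0 : i - j ≠ 0 := sub_ne_zero.mpr hne
  refine ((Set.finite_Icc 0 |i - j|).image fun k : ℤ => rep cs (w ^ k) v).subset ?_
  rintro _ ⟨k, rfl⟩
  refine ⟨k % (i - j), ⟨Int.emod_nonneg k hp0, (Int.emod_lt_abs k hp0).le⟩, ?_⟩
  conv_rhs => rw [← Int.emod_add_mul_ediv k (i - j)]
  simp only
  rw [← rep_zpow_rep_zpow, zpow_mul, rep_zpow_eq_self hp]

lemma finite_sign_changes {w : W} {v : B → ℝ} (hv : IsRoot cs v)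
    (h : Function.Injective fun k : ℤ => rep cs (w ^ k) v) :
    ∃ K : ℕ, (∀ k : ℤ, K ≤ k → (0 ≤ rep cs (w ^ k) v ↔ 0 ≤ rep cs (w ^ (K : ℤ)) v)) ∧
      ∀ k : ℤ, k ≤ -K → (0 ≤ rep cs (w ^ k) v ↔ 0 ≤ rep cs (w ^ (-K : ℤ)) v) := by
  have hfin : {k : ℤ | ¬ (0 ≤ rep cs (w ^ k) v ↔ 0 ≤ rep cs (w ^ (k + 1)) v)}.Finite := by
    refine (((inv_finite cs w).union ((inv_finite cs w).image Neg.neg)).preimage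
      (h.injOn (s := _))).subset fun k hk => ?_
    have hr := hv.rep (w ^ k)
    have e : rep cs (w ^ (k + 1)) v = rep cs w (rep cs (w ^ k) v) := by
      rw [← rep_mul_apply, ← zpow_one_add, add_comm]
    rw [Set.mem_ofPred_eq, e] at hk
    by_cases h0 : 0 ≤ rep cs (w ^ k) v
    · exact Or.inl ⟨hr, h0, by tauto⟩
    · refine Or.inr ⟨-rep cs (w ^ k) v, ⟨hr.neg, hr.neg_nonneg_iff.mpr h0, ?_⟩, neg_neg _⟩
      rw [map_neg, (hr.rep w).neg_nonneg_iff]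
      tauto
  obtain ⟨K, hK⟩ := (hfin.image Int.natAbs).bddAbove
  have hbd : ∀ k : ℤ, K < k.natAbs → (0 ≤ rep cs (w ^ k) v ↔ 0 ≤ rep cs (w ^ (k + 1)) v) := by
    intro k hk
    by_contra hc
    have := hK ⟨k, hc, rfl⟩
    omega
  refine ⟨K + 2, fun k hk => ?_, fun k hk => ?_⟩
  · induction k, hk using Int.leInduction with
    | base => rfl
    | succ k hk ih => rw [← hbd k (by omega), ih]
  · induction k, hk using Int.leInductionDown with
    | base => rfl
    | pred k hk ih =>
      rw [hbd (k - 1) (by omega), sub_add_cancel, ih]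

variable (cs) in
/-- `v` is a root whose translates `w ^ k v` are positive for `k ≤ -K` and negative for `K ≤ k`. -/
def IsOdd (w : W) (K : ℕ) (v : B → ℝ) : Prop :=
  IsRoot cs v ∧ (∀ k : ℤ, k ≤ -K → 0 ≤ rep cs (w ^ k) v) ∧
    ∀ k : ℤ, K ≤ k → ¬ 0 ≤ rep cs (w ^ k) v

lemma exists_isOdd {w : W} (hw : ¬ IsOfFinOrder w) : ∃ v K, IsOdd cs w K v := by
  by_contra hcon
  have key : ∀ v, IsRoot cs v → ∃ F : Set (B → ℝ), F.Finite ∧ ∀ N k : ℕ, k < N →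
      0 ≤ rep cs (w ^ (-k : ℤ)) v → ¬ 0 ≤ rep cs (w ^ (N - k : ℤ)) v →
      rep cs (w ^ (-k : ℤ)) v ∈ F ∨ rep cs (w ^ (N - k : ℤ)) v ∈ F := by
    intro v hv
    by_cases hinj : Function.Injective fun k : ℤ => rep cs (w ^ k) v
    · obtain ⟨K, hp, hm⟩ := finite_sign_changes hv hinj
      refine ⟨(fun k : ℤ => rep cs (w ^ k) v) '' Set.Icc (-K) K, (Set.finite_Icc _ _).image _,
        fun N k hk h1 h2 => ?_⟩
      by_contra hnot
      rw [not_or] at hnot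
      have hk1 : K < k := by
        by_contra hle
        exact hnot.1 ⟨-k, ⟨by omega, by omega⟩, rfl⟩
      have hk2 : (K : ℤ) < N - k := by
        by_contra hle
        exact hnot.2 ⟨N - k, ⟨by omega, by omega⟩, rfl⟩
      rw [hm _ (by omega)] at h1
      rw [hp _ hk2.le] at h2
      exact hcon ⟨v, K, hv, fun j hj => (hm j hj).mpr h1, fun j hj hj' => h2 ((hp j hj).mp hj')⟩
    · exact ⟨_, finite_orbit_of_not_injective hinj, fun N k _ _ _ => Or.inl ⟨_, rfl⟩⟩
  choose! F hFfin hF using key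
  set G : Set (B → ℝ) := ⋃ v ∈ Inv cs w, F v with hG
  have hGfin : G.Finite := (inv_finite cs w).biUnion fun v hv => hFfin v hv.1
  have hsub : ∀ N : ℕ, Inv cs (w ^ N) ⊆ G ∪ rep cs (w ^ N)⁻¹ '' G := by
    intro N x hx
    obtain ⟨hx, hx0, hxN⟩ := hx
    classical
    have hex : ∃ k : ℕ, ¬ 0 ≤ rep cs (w ^ k) x := ⟨N, hxN⟩
    have hfind := Nat.find_spec hex
    have hle : Nat.find hex ≤ N := Nat.find_min' hex hxN
    have hne : Nat.find hex ≠ 0 := fun h => by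
      rw [h, pow_zero, rep_one_apply] at hfind
      exact hfind hx0
    obtain ⟨k, hk⟩ := Nat.exists_eq_succ_of_ne_zero hne
    have hk0 : 0 ≤ rep cs (w ^ k) x := not_not.mp (Nat.find_min hex (by omega))
    rw [hk, Nat.succ_eq_add_one, pow_succ', rep_mul_apply] at hfind
    have hvInv : rep cs (w ^ k) x ∈ Inv cs w := ⟨hx.rep _, hk0, hfind⟩
    have e1 : rep cs (w ^ (-k : ℤ)) (rep cs (w ^ k) x) = x := by
      rw [zpow_neg, zpow_natCast, rep_inv_rep]
    have e2 : rep cs (w ^ (N - k : ℤ)) (rep cs (w ^ k) x) = rep cs (w ^ N) x := by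
      rw [← zpow_natCast w k, rep_zpow_rep_zpow, sub_add_cancel, zpow_natCast]
    have := hF _ (hx.rep (w ^ k)) N k (by omega) (by rw [e1]; exact hx0) (by rw [e2]; exact hxN)
    rw [e1, e2] at this
    rcases this with h | h
    · exact Or.inl (Set.mem_biUnion hvInv h)
    · exact Or.inr ⟨_, Set.mem_biUnion hvInv h, rep_inv_rep _ _ _⟩
  refine Set.infinite_of_injective_forall_mem (injective_pow_iff_not_isOfFinOrder.mpr hw)
    (fun N => ?_) (finite_ncard_inv_le cs (G.ncard + G.ncard))
  calc (Inv cs (w ^ N)).ncard ≤ (G ∪ rep cs (w ^ N)⁻¹ '' G).ncard :=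
        Set.ncard_le_ncard (hsub N) (hGfin.union (hGfin.image _))
    _ ≤ _ := Set.ncard_union_le _ _
    _ ≤ _ := by rw [Set.ncard_image_of_injective _ (rep_injective cs _)]

end OddRoot

section Periodicity

variable [Fintype B] {M : CoxeterMatrix B} {cs : CoxeterSystem M W}

lemma apply_pow_eq_zero_of_window (A : Module.End ℝ (B → ℝ)) (h : (B → ℝ) →ₗ[ℝ] ℝ) (x : B → ℝ)
    (hx : ∀ i < Fintype.card B, h ((A ^ i) x) = 0) (k : ℕ) : h ((A ^ k) x) = 0 := by
  rw [LinearMap.pow_eq_aeval_mod_charpoly]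
  by_cases hB : Fintype.card B = 0
  · have : IsEmpty B := Fintype.card_eq_zero_iff.mp hB
    have : ((Polynomial.aeval A) ((Polynomial.X : Polynomial ℝ) ^ k %ₘ LinearMap.charpoly A)) x =
        0 :=
      Subsingleton.elim _ _
    rw [this, map_zero]
  have hdeg : (LinearMap.charpoly A).natDegree = Fintype.card B := by
    rw [LinearMap.charpoly_natDegree, Module.finrank_fintype_fun_eq_card]
  have hlt : (Polynomial.X ^ k %ₘ LinearMap.charpoly A).natDegree < Fintype.card B := by
    rw [← hdeg]
    refine Polynomial.natDegree_modByMonic_lt _ (LinearMap.charpoly_monic A) fun h1 => ?_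
    rw [h1, Polynomial.natDegree_one] at hdeg
    exact hB hdeg.symm
  rw [Polynomial.aeval_eq_sum_range' hlt, LinearMap.sum_apply, map_sum]
  refine Finset.sum_eq_zero fun i hi => ?_
  rw [LinearMap.smul_apply, map_smul, hx i (Finset.mem_range.mp hi), smul_zero]

lemma apply_zpow_eq_zero_of_window (v : W) (h : (B → ℝ) →ₗ[ℝ] ℝ) (x : B → ℝ)
    (hx : ∀ i < Fintype.card B, h (rep cs (v ^ i) x) = 0) (k : ℤ) : h (rep cs (v ^ k) x) = 0 := by
  set n := Fintype.card B with hn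
  by_cases hk : 0 ≤ k
  · obtain ⟨m, rfl⟩ := Int.eq_ofNat_of_zero_le hk
    rw [zpow_natCast, map_pow]
    exact apply_pow_eq_zero_of_window _ h x (fun i hi => by rw [← map_pow]; exact hx i hi) m
  · have h1 := apply_pow_eq_zero_of_window (rep cs v⁻¹) h (rep cs (v ^ (n - 1 : ℤ)) x)
      (fun i hi => ?_) (n - 1 - k).toNat
    · rw [← map_pow, inv_pow, ← zpow_natCast, ← zpow_neg, rep_zpow_rep_zpow] at h1
      rwa [show -((n - 1 - k).toNat : ℤ) + (n - 1) = k by omega] at h1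
    · rw [← map_pow, inv_pow, ← zpow_natCast, ← zpow_neg, rep_zpow_rep_zpow,
        show -(i : ℤ) + (n - 1) = (n - 1 - i : ℕ) by omega, zpow_natCast]
      exact hx _ (by omega)

variable (cs) in
/-- The number of consecutive crossings that forces periodicity. -/
def windowBound : ℕ := (crossingValues cs).ncard ^ Fintype.card B + Fintype.card B

/-- If the hyperplane of `b` crosses sufficiently many consecutive translates of the hyperplane of
`a`, then the pattern of crossings is periodic. -/
lemma exists_period {v : W} {a b : B → ℝ} (ha : IsRoot cs a) (hb : IsRoot cs b)
    (hab : ∀ j : ℕ, j ≤ windowBound cs → |bil M b (rep cs (v ^ j) a)| < 1) :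
    ∃ q : ℕ, 1 ≤ q ∧ q ≤ windowBound cs ∧ ∀ i : ℤ,
      bil M b (rep cs (v ^ (i + q)) a) = bil M b (rep cs (v ^ i) a) := by
  classical
  set n := Fintype.card B
  set T := crossingValues cs with hT
  have hTfin : T.Finite := finite_crossingValues cs
  have : Fintype T := hTfin.fintype
  set c := T.ncard with hc
  have hN : windowBound cs = c ^ n + n := rfl
  have hval : ∀ j : ℕ, j ≤ windowBound cs → bil M b (rep cs (v ^ j) a) ∈ T := fun j hj =>
    ⟨hab j hj, b, _, hb, ha.rep _, rfl⟩
  set g : Fin (c ^ n + 1) → Fin n → T := fun k i =>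
    ⟨bil M b (rep cs (v ^ (k + i : ℕ)) a), hval _ (by omega)⟩ with hg
  have hcard : Fintype.card (Fin n → T) < Fintype.card (Fin (c ^ n + 1)) := by
    rw [Fintype.card_fun, Fintype.card_fin, Fintype.card_fin, hc, Set.ncard_eq_toFinset_card',
      Set.toFinset_card]
    omega
  obtain ⟨k₁, k₂, hne, heq⟩ := Fintype.exists_ne_map_eq_of_card_lt g hcard
  wlog hlt : k₁ < k₂ generalizing k₁ k₂
  · exact this k₂ k₁ hne.symm heq.symm (lt_of_le_of_ne (not_lt.mp hlt) hne.symm)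
  have hlt' : (k₁ : ℕ) < k₂ := hlt
  have hz := apply_zpow_eq_zero_of_window (cs := cs) v
    (bil M b ∘ₗ (rep cs (v ^ (k₂ : ℕ)) - rep cs (v ^ (k₁ : ℕ)))) a (fun i hi => by
      have := congrArg Subtype.val (congrFun heq ⟨i, hi⟩)
      simp only [hg, pow_add, rep_mul_apply] at this
      rw [LinearMap.comp_apply, LinearMap.sub_apply, map_sub, sub_eq_zero]
      exact this.symm)
  refine ⟨k₂ - k₁, by omega, by omega, fun i => ?_⟩
  have := hz (i - k₁)
  rw [LinearMap.comp_apply, LinearMap.sub_apply, map_sub, sub_eq_zero, ← zpow_natCast,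
    ← zpow_natCast, rep_zpow_rep_zpow, rep_zpow_rep_zpow] at this
  rw [show (k₁ : ℤ) + (i - k₁) = i by ring] at this
  rw [← this, Nat.cast_sub hlt'.le]
  congr 4
  ring

end Periodicity

section FiniteOrbits

lemma eq_of_adj_closed {M : CoxeterMatrix B} (hirr : (coxeterGraph M).Connected)
    {I : Set B} (hI : I.Nonempty)
    (h : ∀ s t, s ∈ I → (coxeterGraph M).Adj s t → t ∈ I) : I = Set.univ := by
  obtain ⟨s, hs⟩ := hI
  refine Set.eq_univ_of_forall fun t => ?_
  obtain ⟨p⟩ := hirr.preconnected s t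
  induction p with
  | nil => exact hs
  | cons hadj _ ih => exact ih (h _ _ hs hadj)

variable [Fintype B] {M : CoxeterMatrix B} {cs : CoxeterSystem M W}

lemma rep_inv_mem {E : Submodule ℝ (B → ℝ)} {g : W} (hg : ∀ v ∈ E, rep cs g v ∈ E)
    {v : B → ℝ} (hv : v ∈ E) : rep cs g⁻¹ v ∈ E := by
  have hmap : E.map (rep cs g) = E :=
    Submodule.eq_of_le_of_finrank_eq (Submodule.map_le_iff_le_comap.mpr hg)
      (Submodule.equivMapOfInjective _ (rep_injective cs g) E).finrank_eq.symm
  rw [← hmap] at hv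
  obtain ⟨u, hu, rfl⟩ := hv
  rwa [rep_inv_rep]

lemma apply_mem_of_simpleRoot {I : Set B} {E : Submodule ℝ (B → ℝ)} (A : Module.End ℝ (B → ℝ))
    (h : ∀ t ∈ I, A (simpleRoot t) ∈ E) {v : B → ℝ} (hv : v ∈ coordSpan I) : A v ∈ E := by
  rw [← sum_smul_simpleRoot v, map_sum]
  refine Submodule.sum_mem _ fun t _ => ?_
  rw [map_smul]
  by_cases ht : t ∈ I
  · exact Submodule.smul_mem _ _ (h t ht)
  · rw [hv t ht, zero_smul]
    exact zero_mem _

lemma refl_rep (δ x : B → ℝ) (g : W) :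
    refl M δ (rep cs g x) = rep cs g (refl M (rep cs g⁻¹ δ) x) := by
  rw [refl_apply, refl_apply, map_sub, map_smul, rep_rep_inv, bil_rep_right]

lemma refl_fix {I : Set B} {δ x : B → ℝ} (h : ∀ t ∈ I, bil M δ (simpleRoot t) = 0)
    (hx : x ∈ coordSpan I) : refl M δ x = x := by
  have : bil M δ x = 0 := by
    rw [bil_eq_sum]
    refine Finset.sum_eq_zero fun t _ => ?_
    by_cases ht : t ∈ I
    · rw [h t ht, mul_zero]
    · rw [hx t ht, zero_mul]
  rw [refl_apply, this, mul_zero, zero_smul, sub_zero]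

lemma IsRoot.refl {δ v : B → ℝ} (hv : IsRoot cs v) (hδ : IsRoot cs δ) :
    IsRoot cs (CoxeterPaper.refl M δ v) := by
  obtain ⟨r, hr⟩ := hδ.exists_reflection
  rw [← hr]
  exact hv.rep r

variable (cs) in
/-- `x` has a finite orbit under the reflections in the roots supported on `J`. -/
def HasFiniteOrbit (J : Set B) (x : B → ℝ) : Prop :=
  ∃ S : Set (B → ℝ), S.Finite ∧ x ∈ S ∧
    ∀ δ, IsRoot cs δ → δ ∈ coordSpan J → ∀ y ∈ S, refl M δ y ∈ S

variable {J : Set B}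

lemma HasFiniteOrbit.refl {x δ : B → ℝ} (h : HasFiniteOrbit cs J x) (hδ : IsRoot cs δ)
    (hJ : δ ∈ coordSpan J) : HasFiniteOrbit cs J (CoxeterPaper.refl M δ x) := by
  obtain ⟨S, hS, hx, hcl⟩ := h
  exact ⟨S, hS, hcl δ hδ hJ x hx, hcl⟩

lemma HasFiniteOrbit.of_refl {x δ : B → ℝ} (hδ : IsRoot cs δ) (hJ : δ ∈ coordSpan J)
    (h : HasFiniteOrbit cs J (CoxeterPaper.refl M δ x)) : HasFiniteOrbit cs J x := by
  have := h.refl hδ hJ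
  rwa [refl_refl M hδ.bil_self] at this

lemma HasFiniteOrbit.rep {x : B → ℝ} (h : HasFiniteOrbit cs J x) {g : W}
    (hg : ∀ v ∈ coordSpan J, CoxeterPaper.rep cs g v ∈ coordSpan J) :
    HasFiniteOrbit cs J (CoxeterPaper.rep cs g x) := by
  obtain ⟨S, hS, hx, hcl⟩ := h
  refine ⟨_, hS.image (CoxeterPaper.rep cs g), Set.mem_image_of_mem _ hx, ?_⟩
  rintro δ hδ hJ _ ⟨y, hy, rfl⟩
  rw [refl_rep]
  exact Set.mem_image_of_mem _ (hcl _ (hδ.rep _) (rep_inv_mem hg hJ) y hy)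

lemma HasFiniteOrbit.smul_sub {x y : B → ℝ} (hx : HasFiniteOrbit cs J x)
    (hy : HasFiniteOrbit cs J y) (c : ℝ) : HasFiniteOrbit cs J (c • (x - y)) := by
  obtain ⟨S, hS, hxS, hcl⟩ := hx
  obtain ⟨T, hT, hyT, hcl'⟩ := hy
  refine ⟨Set.image2 (fun a b => c • (a - b)) S T, hS.image2 _ hT,
    Set.mem_image2_of_mem hxS hyT, ?_⟩
  rintro δ hδ hJ _ ⟨a, ha, b, hb, rfl⟩
  rw [map_smul, map_sub]
  exact Set.mem_image2_of_mem (hcl δ hδ hJ a ha) (hcl' δ hδ hJ b hb)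

lemma inv_smul_sub_refl {δ γ : B → ℝ} (h : bil M γ δ ≠ 0) :
    (2 * bil M γ δ)⁻¹ • (δ - refl M γ δ) = γ := by
  rw [refl_apply, sub_sub_cancel, smul_smul, inv_mul_cancel₀ (mul_ne_zero two_ne_zero h), one_smul]

lemma HasFiniteOrbit.bil_eq_zero {δ γ : B → ℝ} (hδ : HasFiniteOrbit cs J δ) (hγ : IsRoot cs γ)
    (hJ : γ ∈ coordSpan J) (hinf : ¬ HasFiniteOrbit cs J γ) : bil M δ γ = 0 := by
  rw [bil_symm]
  by_contra h
  refine hinf ?_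
  rw [← inv_smul_sub_refl h]
  exact hδ.smul_sub (hδ.refl hγ hJ) _

variable (cs J) in
/-- The simple roots supported on `J` with an infinite orbit. -/
def infinitePart : Set B := {t ∈ J | ¬ HasFiniteOrbit cs J (simpleRoot t)}

lemma mem_coordSpan_infinitePart {γ : B → ℝ} (hγ : IsRoot cs γ) (hJ : γ ∈ coordSpan J)
    (hinf : ¬ HasFiniteOrbit cs J γ) : γ ∈ coordSpan (infinitePart cs J) := by
  have key : ∀ γ, IsRoot cs γ → 0 ≤ γ → γ ∈ coordSpan J → ¬ HasFiniteOrbit cs J γ →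
      γ ∈ coordSpan (infinitePart cs J) := by
    intro γ hγ h0 hJ
    refine hγ.induction_coordSpan (cs := cs) (J := J)
      (p := fun v => ¬ HasFiniteOrbit cs J v → v ∈ coordSpan (infinitePart cs J)) ?_ ?_ h0 hJ
    · intro t ht hinf
      exact simpleRoot_mem_coordSpan.mpr (show t ∈ infinitePart cs J from ⟨ht, hinf⟩)
    · intro v s hs hv hvJ ih hinf
      rw [rep_simple] at hinf ⊢
      have hsJ := simpleRoot_mem_coordSpan.mpr hs
      have hv' : ¬ HasFiniteOrbit cs J v := fun h => hinf (h.refl (isRoot_simpleRoot s) hsJ)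
      by_cases hfin : HasFiniteOrbit cs J (simpleRoot s)
      · rw [refl_apply, hfin.bil_eq_zero hv hvJ hv', mul_zero, zero_smul, sub_zero]
        exact ih hv'
      · rw [← rep_simple cs]
        exact rep_simple_mem_coordSpan (show s ∈ infinitePart cs J from ⟨hs, hfin⟩) (ih hv')
  rcases hγ.nonneg_or_nonpos with h | h
  · exact key γ hγ h hJ hinf
  · rw [← neg_mem_iff]
    refine key _ hγ.neg (neg_nonneg.mpr h) (neg_mem hJ) fun hfin => hinf ?_
    refine HasFiniteOrbit.of_refl hγ hJ ?_
    rwa [refl_apply, hγ.bil_self, show γ - (2 * 1 : ℝ) • γ = -γ by module]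

lemma HasFiniteOrbit.refl_fix {δ x : B → ℝ} (hδ : HasFiniteOrbit cs J δ)
    (hx : x ∈ coordSpan (infinitePart cs J)) : CoxeterPaper.refl M δ x = x :=
  CoxeterPaper.refl_fix (fun t ht => hδ.bil_eq_zero (isRoot_simpleRoot t)
    (simpleRoot_mem_coordSpan.mpr ht.1) ht.2) hx

lemma infinitePart_nonempty (hinf : {γ | IsRoot cs γ ∧ γ ∈ coordSpan J}.Infinite) :
    (infinitePart cs J).Nonempty := by
  by_contra hemp
  rw [Set.not_nonempty_iff_eq_empty] at hemp
  have hfin : ∀ t ∈ J, HasFiniteOrbit cs J (simpleRoot t) := fun t ht => by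
    by_contra h
    have : t ∈ infinitePart cs J := ⟨ht, h⟩
    rw [hemp] at this
    exact this
  choose! S hS hmem hcl using hfin
  have hU : (⋃ t ∈ J, S t).Finite := (Set.toFinite J).biUnion hS
  have key : ∀ γ, IsRoot cs γ → 0 ≤ γ → γ ∈ coordSpan J → γ ∈ ⋃ t ∈ J, S t := by
    intro γ hγ h0 hJ
    refine hγ.induction_coordSpan (cs := cs) (J := J) (p := fun v => v ∈ ⋃ t ∈ J, S t) ?_ ?_ h0 hJ
    · exact fun t ht => Set.mem_biUnion ht (hmem t ht)
    · intro v s hs _ _ hv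
      obtain ⟨t, ht, hvt⟩ := Set.mem_iUnion₂.mp hv
      refine Set.mem_biUnion ht ?_
      rw [rep_simple]
      exact hcl t ht _ (isRoot_simpleRoot s) (simpleRoot_mem_coordSpan.mpr hs) v hvt
  refine hinf ((hU.union (hU.image Neg.neg)).subset fun γ hγ => ?_)
  rcases hγ.1.nonneg_or_nonpos with h | h
  · exact Or.inl (key γ hγ.1 h hγ.2)
  · exact Or.inr ⟨-γ, key _ hγ.1.neg (neg_nonneg.mpr h) (neg_mem hγ.2), neg_neg _⟩

lemma mul_simple_map_coordSpan {d : W} {I : Set B} {s : B}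
    (hd : ∀ v ∈ coordSpan I, rep cs d v ∈ coordSpan I)
    (hs : ∀ v ∈ coordSpan I, rep cs (cs.simple s) v ∈ coordSpan I) :
    ∀ v ∈ coordSpan I, rep cs (d * cs.simple s) v ∈ coordSpan I := fun v hv => by
  rw [rep_mul_apply]
  exact hd _ (hs v hv)

/-- If `d` preserves the span of the infinite part and sends a simple root outside it to a
negative root, then that simple root is orthogonal to the infinite part. -/
lemma bil_infinitePart_eq_zero {d : W} {s : B}
    (hd : ∀ v ∈ coordSpan (infinitePart cs J), rep cs d v ∈ coordSpan (infinitePart cs J))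
    (hs : ¬ 0 ≤ rep cs d (simpleRoot s)) (hsI : s ∉ infinitePart cs J) :
    ∀ t ∈ infinitePart cs J, bil M (simpleRoot s) (simpleRoot t) = 0 := by
  intro t ht
  set I := infinitePart cs J with hI
  by_contra hne
  have hts : t ≠ s := fun h => hsI (h ▸ ht)
  have hnot : rep cs d (simpleRoot s) ∉ coordSpan I := fun h => by
    have := rep_inv_mem hd h
    rw [rep_inv_rep, simpleRoot_mem_coordSpan] at this
    exact hsI this
  obtain ⟨r, hrI, hr⟩ : ∃ r, r ∉ I ∧ rep cs d (simpleRoot s) r ≠ 0 := by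
    simpa [mem_coordSpan] using hnot
  have hr0 : rep cs d (simpleRoot s) r < 0 :=
    lt_of_le_of_ne (((isRoot_simpleRoot s).rep d).nonpos hs r) hr
  set Ψ : Set (B → ℝ) := {γ | IsRoot cs γ ∧ γ ∈ coordSpan (insert s I) ∧ 0 < γ s} with hΨ
  have hpos : ∀ γ ∈ Ψ, 0 ≤ γ := fun γ hγ => by
    by_contra h
    exact absurd (hγ.1.nonpos h s) (not_le.mpr hγ.2.2)
  have hΨfin : Ψ.Finite := by
    refine (inv_finite cs d).subset fun γ hγ => ⟨hγ.1, hpos γ hγ, fun h => ?_⟩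
    have he : γ - γ s • simpleRoot s ∈ coordSpan I := by
      intro q hq
      by_cases hqs : q = s
      · subst hqs; simp [simpleRoot_self]
      · simp [simpleRoot_of_ne hqs, hγ.2.1 q (by simp [hqs, hq])]
    have h1 := hd _ he r hrI
    rw [map_sub, map_smul, Pi.sub_apply, Pi.smul_apply, smul_eq_mul, sub_eq_zero] at h1
    have h2 := h r
    rw [h1, Pi.zero_apply] at h2
    exact absurd h2 (not_le.mpr (mul_neg_of_pos_of_neg hγ.2.2 hr0))
  have hΨrefl : ∀ δ, IsRoot cs δ → δ ∈ coordSpan I → ∀ o ∈ Ψ, refl M δ o ∈ Ψ := by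
    intro δ hδ hδI o ho
    refine ⟨ho.1.refl hδ, fun q hq => ?_, ?_⟩
    · rw [Set.mem_insert_iff, not_or] at hq
      rw [refl_apply, Pi.sub_apply, Pi.smul_apply, hδI q hq.2,
        ho.2.1 q (by rw [Set.mem_insert_iff, not_or]; exact hq)]
      simp
    · rw [refl_apply, Pi.sub_apply, Pi.smul_apply, hδI s hsI, smul_zero, sub_zero]
      exact ho.2.2
  have hsΨ : simpleRoot s ∈ Ψ :=
    ⟨isRoot_simpleRoot s, simpleRoot_mem_coordSpan.mpr (Set.mem_insert _ _), by
      rw [simpleRoot_self]; exact one_pos⟩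
  have htI : simpleRoot t ∈ coordSpan I := simpleRoot_mem_coordSpan.mpr ht
  rw [bil_symm] at hne
  set c := (2 * bil M (simpleRoot t) (simpleRoot s))⁻¹ with hc
  refine ht.2 ⟨{x | x ∈ coordSpan I ∧ x ∈ Set.image2 (fun a b => c • (a - b)) Ψ Ψ},
    (hΨfin.image2 _ hΨfin).subset fun x hx => hx.2,
    ⟨htI, _, hsΨ, _, hΨrefl _ (isRoot_simpleRoot t) htI _ hsΨ, inv_smul_sub_refl hne⟩, ?_⟩
  rintro δ hδ hδJ x ⟨hxI, hx⟩
  by_cases hfin : HasFiniteOrbit cs J δ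
  · rw [hfin.refl_fix hxI]
    exact ⟨hxI, hx⟩
  · have hδI := mem_coordSpan_infinitePart hδ hδJ hfin
    refine ⟨?_, ?_⟩
    · rw [refl_apply]
      exact sub_mem hxI (Submodule.smul_mem _ _ hδI)
    · obtain ⟨a, ha, b, hb, rfl⟩ := hx
      exact ⟨_, hΨrefl δ hδ hδI a ha, _, hΨrefl δ hδ hδI b hb, by rw [map_smul, map_sub]⟩

lemma mem_standardParabolic_of_map_infinitePart {d : W}
    (hd : ∀ v ∈ coordSpan (infinitePart cs J), rep cs d v ∈ coordSpan (infinitePart cs J)) :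
    d ∈ standardParabolic cs (infinitePart cs J ∪
      {s | ∀ t ∈ infinitePart cs J, bil M (simpleRoot s) (simpleRoot t) = 0}) := by
  induction hn : cs.length d using Nat.strong_induction_on generalizing d with
  | _ n ih =>
  by_cases h1 : d = 1
  · rw [h1]; exact one_mem _
  obtain ⟨s, hs⟩ := exists_not_nonneg (cs := cs) h1
  have hlt := isRightDescent_of_not_nonneg hs
  have hboth : s ∈ infinitePart cs J ∪
      {s | ∀ t ∈ infinitePart cs J, bil M (simpleRoot s) (simpleRoot t) = 0} ∧
      ∀ v ∈ coordSpan (infinitePart cs J),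
        rep cs (cs.simple s) v ∈ coordSpan (infinitePart cs J) := by
    by_cases hsI : s ∈ infinitePart cs J
    · exact ⟨Or.inl hsI, fun v hv => rep_simple_mem_coordSpan hsI hv⟩
    · have h0 := bil_infinitePart_eq_zero hd hs hsI
      refine ⟨Or.inr h0, fun v hv => ?_⟩
      rw [rep_simple, refl_fix h0 hv]
      exact hv
  have := mul_mem (ih _ (hn ▸ hlt) (mul_simple_map_coordSpan hd hboth.2) rfl)
    (Subgroup.subset_closure (Set.mem_image_of_mem cs.simple hboth.1))
  rwa [cs.simple_mul_simple_cancel_right] at this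

/-- An element preserving an infinite set of roots of the form `Φ_J`, `J` proper, lies in a proper
standard parabolic subgroup. -/
lemma exists_mem_standardParabolic (hirr : (coxeterGraph M).Connected) (hJ : J ≠ Set.univ)
    (hinf : {γ | IsRoot cs γ ∧ γ ∈ coordSpan J}.Infinite) {g : W}
    (hg : ∀ v ∈ coordSpan J, rep cs g v ∈ coordSpan J) :
    ∃ X : Set B, X ≠ Set.univ ∧ g ∈ standardParabolic cs X := by
  refine ⟨_, fun huniv => hJ ?_, mem_standardParabolic_of_map_infinitePart (cs := cs) (J := J)
    fun v hv => apply_mem_of_simpleRoot _ (fun t ht => ?_) hv⟩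
  · refine Set.eq_univ_of_univ_subset ?_
    rw [← eq_of_adj_closed hirr (infinitePart_nonempty hinf) fun s t hs hadj => ?_]
    · exact fun t ht => ht.1
    · rcases (huniv ▸ Set.mem_univ t : t ∈ _) with h | h
      · exact h
      · have := h s hs
        rw [bil_simpleRoot, formEntry_symm] at this
        exact absurd this (formEntry_neg M hadj).ne
  · refine mem_coordSpan_infinitePart ((isRoot_simpleRoot t).rep g)
      (hg _ (simpleRoot_mem_coordSpan.mpr ht.1)) fun h => ht.2 ?_
    have := h.rep (g := g⁻¹) fun v hv => rep_inv_mem hg hv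
    rwa [rep_inv_rep] at this

end FiniteOrbits

section Annihilators

variable [Fintype B] {M : CoxeterMatrix B} {cs : CoxeterSystem M W}

lemma finite_negSet_comp {f : (B → ℝ) →ₗ[ℝ] ℝ} (hf : (negSet cs f).Finite) (g : W) :
    (negSet cs (f ∘ₗ rep cs g)).Finite := by
  refine ((inv_finite cs g).union (hf.image (rep cs g⁻¹))).subset ?_
  rintro v ⟨hv, h0, hlt⟩
  by_cases hg : 0 ≤ rep cs g v
  · exact Or.inr ⟨_, ⟨hv.rep g, hg, hlt⟩, rep_inv_rep cs g v⟩
  · exact Or.inl ⟨hv, h0, hg⟩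

variable (cs) in
/-- The roots on which a linear functional vanishes. -/
def zeroSet (f : (B → ℝ) →ₗ[ℝ] ℝ) : Set (B → ℝ) := {v | IsRoot cs v ∧ f v = 0}

lemma exists_add_smul {f f' : (B → ℝ) →ₗ[ℝ] ℝ} (hf : (negSet cs f).Finite)
    (hf' : (negSet cs f').Finite) : ∃ t : ℝ, (negSet cs (f + t • f')).Finite ∧
      zeroSet cs (f + t • f') ⊆ zeroSet cs f ∩ zeroSet cs f' := by
  have hfin := hf.union hf'
  obtain ⟨t, ht0, ht⟩ := (Set.Ioi_infinite (0 : ℝ)).exists_notMem_finite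
    (hfin.image fun γ => -(f γ) / f' γ)
  have ht0' : 0 < t := ht0
  refine ⟨t, hfin.subset ?_, ?_⟩
  · rintro v ⟨hv, h0, hlt⟩
    by_contra hcon
    rw [Set.mem_union, not_or] at hcon
    have h1 : 0 ≤ f v := not_lt.mp fun h => hcon.1 ⟨hv, h0, h⟩
    have h2 : 0 ≤ f' v := not_lt.mp fun h => hcon.2 ⟨hv, h0, h⟩
    have h3 : f v + t * f' v < 0 := hlt
    nlinarith
  · have key : ∀ v, IsRoot cs v → 0 ≤ v → f v + t * f' v = 0 → f v = 0 ∧ f' v = 0 := by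
      intro v hv h0 hz
      by_cases h' : f' v = 0
      · rw [h', mul_zero, add_zero] at hz
        exact ⟨hz, h'⟩
      have hnot : v ∉ negSet cs f ∪ negSet cs f' := fun hmem => ht ⟨v, hmem, by
        simp only
        rw [div_eq_iff h']
        linarith⟩
      rw [Set.mem_union, not_or] at hnot
      have h1 : 0 ≤ f v := not_lt.mp fun h => hnot.1 ⟨hv, h0, h⟩
      have h2 : 0 < f' v := lt_of_le_of_ne (not_lt.mp fun h => hnot.2 ⟨hv, h0, h⟩) (Ne.symm h')
      nlinarith [mul_pos ht0' h2]
    rintro v ⟨hv, hz⟩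
    have hz' : f v + t * f' v = 0 := hz
    rcases hv.nonneg_or_nonpos with h | h
    · exact ⟨⟨hv, (key v hv h hz').1⟩, hv, (key v hv h hz').2⟩
    · have := key _ hv.neg (neg_nonneg.mpr h) (by rw [map_neg, map_neg]; linarith)
      rw [map_neg, map_neg, neg_eq_zero, neg_eq_zero] at this
      exact ⟨⟨hv, this.1⟩, hv, this.2⟩

lemma exists_zeroSet_subset {𝓕 : Set ((B → ℝ) →ₗ[ℝ] ℝ)} (hne : 𝓕.Nonempty)
    (hfin : ∀ f ∈ 𝓕, (negSet cs f).Finite)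
    (hadd : ∀ f ∈ 𝓕, ∀ f' ∈ 𝓕, ∀ t : ℝ, (negSet cs (f + t • f')).Finite → f + t • f' ∈ 𝓕) :
    ∃ f ∈ 𝓕, ∀ f' ∈ 𝓕, zeroSet cs f ⊆ zeroSet cs f' := by
  obtain ⟨_, ⟨f, hf, rfl⟩, hmin⟩ := wellFounded_lt.has_min
    ((fun f => Submodule.span ℝ (zeroSet cs f)) '' 𝓕) (hne.image _)
  refine ⟨f, hf, fun f' hf' v hv => ⟨hv.1, ?_⟩⟩
  obtain ⟨t, htfin, ht⟩ := exists_add_smul (hfin f hf) (hfin f' hf')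
  have hle : Submodule.span ℝ (zeroSet cs (f + t • f')) ≤ Submodule.span ℝ (zeroSet cs f) :=
    Submodule.span_mono fun v hv => (ht hv).1
  have heq := eq_of_le_of_not_lt hle
    (hmin _ (Set.mem_image_of_mem _ (hadd f hf f' hf' t htfin)))
  have hker : Submodule.span ℝ (zeroSet cs (f + t • f')) ≤ LinearMap.ker f' :=
    Submodule.span_le.mpr fun v hv => (ht hv).2.2
  rw [heq] at hker
  exact hker (Submodule.subset_span hv)

/-- A linear functional that is negative on finitely many positive roots only and vanishes on an
infinite set of roots stable under an essential element is zero. -/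
lemma IsEssential.eq_zero_of_forall_mem (hirr : (coxeterGraph M).Connected) {w : W}
    (hw : IsEssential cs w) {Y : Set (B → ℝ)} (hYinf : Y.Infinite) (hY : ∀ y ∈ Y, IsRoot cs y)
    (hYw : ∀ y ∈ Y, rep cs w y ∈ Y) {f : (B → ℝ) →ₗ[ℝ] ℝ} (hf : (negSet cs f).Finite)
    (hfY : ∀ y ∈ Y, f y = 0) : f = 0 := by
  by_contra hf0
  obtain ⟨φ, ⟨hφfin, hφY⟩, hφ⟩ := exists_zeroSet_subset (cs := cs)
    (𝓕 := {f | (negSet cs f).Finite ∧ ∀ y ∈ Y, f y = 0}) ⟨f, hf, hfY⟩ (fun f h => h.1)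
    (fun f h f' h' t ht => ⟨ht, fun y hy => by
      rw [LinearMap.add_apply, LinearMap.smul_apply, h.2 y hy, h'.2 y hy, smul_zero, add_zero]⟩)
  obtain ⟨u, hu⟩ := exists_dominant hφfin
  set F := φ ∘ₗ rep cs u with hF
  have hFφ : ∀ x, φ x = F (rep cs u⁻¹ x) := fun x => by
    rw [hF, LinearMap.comp_apply, rep_rep_inv]
  set J : Set B := {s | F (simpleRoot s) = 0} with hJ
  have hroot : ∀ {γ}, IsRoot cs γ → (F γ = 0 ↔ γ ∈ coordSpan J) := fun hγ =>
    apply_eq_zero_iff_mem_coordSpan hu hγ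
  have hJne : J ≠ Set.univ := by
    intro huniv
    have hφ0 : ∀ x, φ x = 0 := fun x => by
      rw [hFφ, eq_sum_of_linear]
      refine Finset.sum_eq_zero fun s _ => ?_
      rw [(huniv ▸ Set.mem_univ s : s ∈ J), mul_zero]
    refine hf0 (LinearMap.ext fun x => ?_)
    rw [eq_sum_of_linear]
    refine Finset.sum_eq_zero fun s _ => ?_
    rw [(hφ f ⟨hf, hfY⟩ ⟨isRoot_simpleRoot s, hφ0 _⟩).2, mul_zero]
  have hJinf : {γ | IsRoot cs γ ∧ γ ∈ coordSpan J}.Infinite := by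
    refine (hYinf.image ((rep_injective cs u⁻¹).injOn)).mono ?_
    rintro _ ⟨y, hy, rfl⟩
    have hr := (hY y hy).rep u⁻¹
    exact ⟨hr, (hroot hr).mp (by rw [← hFφ, hφY y hy])⟩
  have hg : ∀ v ∈ coordSpan J, rep cs (u⁻¹ * w * u) v ∈ coordSpan J := fun v hv => by
    refine apply_mem_of_simpleRoot _ (fun s hs => ?_) hv
    have hs' := (isRoot_simpleRoot (cs := cs) s).rep u
    have := (hφ (φ ∘ₗ rep cs w) ⟨finite_negSet_comp hφfin w, fun y hy => hφY _ (hYw y hy)⟩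
      ⟨hs', hs⟩).2
    refine (hroot ((isRoot_simpleRoot s).rep _)).mp ?_
    rw [rep_mul_apply, rep_mul_apply, ← hFφ]
    exact this
  obtain ⟨X, hX, hmem⟩ := exists_mem_standardParabolic hirr hJne hJinf hg
  exact hX (hw.eq_univ (u := u⁻¹) (by rwa [inv_inv]))

end Annihilators

section PositiveSemidefinite

variable [Fintype B] {M : CoxeterMatrix B}

lemma bil_simpleRoot_right (x : B → ℝ) (t : B) :
    bil M x (simpleRoot t) = ∑ s, x s * formEntry M s t := by
  rw [bil_symm, bil_eq_sum]
  exact Finset.sum_congr rfl fun s _ => by rw [bil_simpleRoot, formEntry_symm]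

lemma pos_of_orthogonal (hirr : (coxeterGraph M).Connected) {κ : B → ℝ} (h0 : 0 ≤ κ) (hne : κ ≠ 0)
    (horth : ∀ s, bil M κ (simpleRoot s) = 0) (s : B) : 0 < κ s := by
  have hI : {s | 0 < κ s} = Set.univ := by
    refine eq_of_adj_closed hirr ?_ fun s t hs hadj => ?_
    · obtain ⟨s, hs⟩ := Function.ne_iff.mp hne
      exact ⟨s, lt_of_le_of_ne (h0 s) (Ne.symm hs)⟩
    · by_contra ht
      have ht0 : κ t = 0 := le_antisymm (not_lt.mp ht) (h0 t)
      have hsum := horth t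
      rw [bil_simpleRoot_right, Finset.sum_eq_zero_iff_of_nonpos fun r _ => ?_] at hsum
      · have := hsum s (Finset.mem_univ s)
        exact absurd this (mul_neg_of_pos_of_neg hs (formEntry_neg M hadj)).ne
      · by_cases hr : r = t
        · rw [hr, ht0, zero_mul]
        · exact mul_nonpos_of_nonneg_of_nonpos (h0 r) (formEntry_nonpos M hr)
  exact (hI ▸ Set.mem_univ s : s ∈ {s | 0 < κ s})

lemma canonicalForm_nonneg_of_orthogonal (hirr : (coxeterGraph M).Connected) {κ : B → ℝ}
    (h0 : 0 ≤ κ) (hne : κ ≠ 0) (horth : ∀ s, bil M κ (simpleRoot s) = 0) (x : B → ℝ) :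
    0 ≤ canonicalForm M x x := by
  have hpos := pos_of_orthogonal hirr h0 hne horth
  set y : B → ℝ := fun s => x s / κ s with hy
  have hx : ∀ s, x s = κ s * y s := fun s => by
    rw [hy]; field_simp [(hpos s).ne']
  have hcol : ∀ t, ∑ s, κ s * formEntry M s t = 0 := fun t => by
    rw [← bil_simpleRoot_right, horth]
  have hrow : ∀ s, ∑ t, κ t * formEntry M s t = 0 := fun s => by
    rw [← hcol s]
    exact Finset.sum_congr rfl fun t _ => by rw [formEntry_symm]
  have h1 : ∑ s, ∑ t, κ s * κ t * formEntry M s t * y s ^ 2 = 0 := by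
    refine Finset.sum_eq_zero fun s _ => ?_
    calc _ = κ s * y s ^ 2 * ∑ t, κ t * formEntry M s t := by
          rw [Finset.mul_sum]; exact Finset.sum_congr rfl fun t _ => by ring
      _ = 0 := by rw [hrow, mul_zero]
  have h2 : ∑ s, ∑ t, κ s * κ t * formEntry M s t * y t ^ 2 = 0 := by
    rw [Finset.sum_comm]
    refine Finset.sum_eq_zero fun t _ => ?_
    calc _ = κ t * y t ^ 2 * ∑ s, κ s * formEntry M s t := by
          rw [Finset.mul_sum]; exact Finset.sum_congr rfl fun t _ => by ring
      _ = 0 := by rw [hcol, mul_zero]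
  have h3 : ∑ s, ∑ t, κ s * κ t * formEntry M s t * (y s - y t) ^ 2 ≤ 0 := by
    refine Finset.sum_nonpos fun s _ => Finset.sum_nonpos fun t _ => ?_
    by_cases hst : s = t
    · rw [hst, sub_self]; simp
    · exact mul_nonpos_of_nonpos_of_nonneg (mul_nonpos_of_nonneg_of_nonpos
        (mul_nonneg (h0 s) (h0 t)) (formEntry_nonpos M hst)) (sq_nonneg _)
  have h4 : ∑ s, ∑ t, κ s * κ t * formEntry M s t * (y s - y t) ^ 2 =
      ∑ s, ∑ t, κ s * κ t * formEntry M s t * y s ^ 2 +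
      ∑ s, ∑ t, κ s * κ t * formEntry M s t * y t ^ 2 - 2 * canonicalForm M x x := by
    rw [canonicalForm, Finset.mul_sum, ← Finset.sum_add_distrib, ← Finset.sum_sub_distrib]
    refine Finset.sum_congr rfl fun s _ => ?_
    rw [Finset.mul_sum, ← Finset.sum_add_distrib, ← Finset.sum_sub_distrib]
    refine Finset.sum_congr rfl fun t _ => ?_
    rw [hx s, hx t]
    ring
  linarith

end PositiveSemidefinite

section FinitelyManyCrossings

variable [Fintype B] {M : CoxeterMatrix B} {cs : CoxeterSystem M W}

lemma IsRoot.neg_one_lt_bil {a b : B → ℝ} (ha : IsRoot cs a) (hb : IsRoot cs b) {x y : W}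
    (hxa : 0 ≤ CoxeterPaper.rep cs x a) (hxb : 0 ≤ CoxeterPaper.rep cs x b)
    (hya : ¬ 0 ≤ CoxeterPaper.rep cs y a) (hyb : ¬ 0 ≤ CoxeterPaper.rep cs y b) :
    -1 < bil M a b := by
  by_contra h
  exact (ha.nonneg_or_nonneg_of_bil_le hb (not_lt.mp h) hxa hxb y).elim hya hyb

lemma exists_antidominant_pair {a b : B → ℝ} (ha : IsRoot cs a) (hb : IsRoot cs b)
    (hab : bil M a b ≤ -1) {x : W} (hxa : 0 ≤ rep cs x a) (hxb : 0 ≤ rep cs x b) :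
    ∃ u, 0 ≤ rep cs u a ∧ 0 ≤ rep cs u b ∧ ∀ s, bil M (rep cs u (a + b)) (simpleRoot s) ≤ 0 := by
  set H := ht (rep cs x a) + ht (rep cs x b) with hH
  set T : Set ((B → ℝ) × (B → ℝ)) := {p | (∃ u, rep cs u a = p.1 ∧ rep cs u b = p.2) ∧
    0 ≤ p.1 ∧ 0 ≤ p.2 ∧ ht p.1 + ht p.2 ≤ H} with hT
  have hTfin : T.Finite := by
    refine ((finite_ht_le cs H).prod (finite_ht_le cs H)).subset ?_
    rintro ⟨p, q⟩ ⟨⟨u, rfl, rfl⟩, hp, hq, hle⟩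
    have h1 := ht_nonneg hp
    have h2 := ht_nonneg hq
    simp only at hle h1 h2
    exact ⟨⟨ha.rep u, hp, by linarith⟩, hb.rep u, hq, by linarith⟩
  obtain ⟨⟨p, q⟩, ⟨⟨u, hup, huq⟩, hp, hq, hle⟩, hmin⟩ := Set.exists_min_image T
    (fun p => ht p.1 + ht p.2) hTfin ⟨(rep cs x a, rep cs x b), ⟨x, rfl, rfl⟩, hxa, hxb, le_rfl⟩
  simp only at hup huq hp hq hle
  subst hup huq
  refine ⟨u, hp, hq, fun s => ?_⟩
  rw [map_add, map_add, LinearMap.add_apply]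
  by_contra hpos
  have hpq : bil M (rep cs u a) (rep cs u b) ≤ -1 := by rwa [bil_rep]
  have hqp : bil M (rep cs u b) (rep cs u a) ≤ -1 := by rwa [bil_symm]
  have hps : rep cs u a ≠ simpleRoot s := fun h => by
    rw [← h, (ha.rep u).bil_self] at hpos
    linarith
  have hqs : rep cs u b ≠ simpleRoot s := fun h => by
    rw [← h, (hb.rep u).bil_self] at hpos
    linarith
  have h1 := ht_rep_simple (cs := cs) s (rep cs u a)
  have h2 := ht_rep_simple (cs := cs) s (rep cs u b)
  have := hmin (rep cs (cs.simple s) (rep cs u a), rep cs (cs.simple s) (rep cs u b))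
    ⟨⟨cs.simple s * u, rep_mul_apply _ _ _ _, rep_mul_apply _ _ _ _⟩,
      (ha.rep u).rep_simple_nonneg hp hps, (hb.rep u).rep_simple_nonneg hq hqs, by
        simp only; linarith⟩
  simp only at this
  linarith

/-- Under an essential element, the roots orthogonal to a hyperbolic pair of roots contain no
infinite stable set. -/
lemma IsEssential.finite_of_orthogonal_pair (hirr : (coxeterGraph M).Connected)
    (hform : ¬ ∀ x : B → ℝ, 0 ≤ canonicalForm M x x) {w : W} (hw : IsEssential cs w)
    {a b : B → ℝ} (ha : IsRoot cs a) (hb : IsRoot cs b) (hab : bil M a b ≤ -1) {x : W}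
    (hxa : 0 ≤ rep cs x a) (hxb : 0 ≤ rep cs x b) {Y : Set (B → ℝ)} (hY : ∀ y ∈ Y, IsRoot cs y)
    (hYw : ∀ y ∈ Y, rep cs w y ∈ Y) (horth : ∀ y ∈ Y, bil M (a + b) y = 0) : Y.Finite := by
  by_contra hinf
  obtain ⟨u, hua, hub, hu⟩ := exists_antidominant_pair ha hb hab hxa hxb
  have hfin : (negSet cs (-bil M (rep cs u (a + b)))).Finite := by
    refine Set.finite_empty.subset ?_
    rintro v ⟨-, h0, hlt⟩
    rw [LinearMap.neg_apply, bil_eq_sum, neg_lt_zero] at hlt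
    exact absurd hlt (not_lt.mpr (Finset.sum_nonpos fun s _ =>
      mul_nonpos_of_nonneg_of_nonpos (h0 s) (hu s)))
  have hcomp : ∀ y, ((-bil M (rep cs u (a + b))) ∘ₗ rep cs u) y = -bil M (a + b) y := fun y => by
    rw [LinearMap.comp_apply, LinearMap.neg_apply, bil_rep]
  have hzero := hw.eq_zero_of_forall_mem hirr hinf hY hYw (finite_negSet_comp hfin u)
    fun y hy => by rw [hcomp, horth y hy, neg_zero]
  refine hform (canonicalForm_nonneg_of_orthogonal hirr (κ := rep cs u (a + b)) ?_ ?_ fun s => ?_)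
  · rw [map_add]
    exact add_nonneg hua hub
  · intro h
    have h1 := (ha.rep u).ht_pos hua
    have h2 := (hb.rep u).ht_pos hub
    have h3 : ht (rep cs u (a + b)) = 0 := by rw [h, map_zero]
    rw [map_add, map_add] at h3
    linarith
  · have := hcomp (rep cs u⁻¹ (simpleRoot s))
    rw [hzero, LinearMap.zero_apply, ← bil_rep (cs := cs) u, rep_rep_inv] at this
    linarith

variable (cs) in
/-- The roots whose hyperplanes cross all hyperplanes of `w ^ j α`, `j ≤ windowBound cs`. -/
def crossingRoots (w : W) (α : B → ℝ) : Set (B → ℝ) :=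
  {β | IsRoot cs β ∧ ∀ j : ℕ, j ≤ windowBound cs → |bil M β (rep cs (w ^ j) α)| < 1}

variable (cs) in
/-- The roots whose pattern of crossings with the hyperplanes of `w ^ i α` has period `q`. -/
def periodicRoots (w : W) (α : B → ℝ) (q : ℕ) : Set (B → ℝ) :=
  {β | IsRoot cs β ∧ ∀ i : ℤ, bil M β (rep cs (w ^ (i + q)) α) = bil M β (rep cs (w ^ i) α)}

lemma rep_mem_periodicRoots {w : W} {α β : B → ℝ} {q : ℕ} (hβ : β ∈ periodicRoots cs w α q) :
    rep cs w β ∈ periodicRoots cs w α q := by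
  refine ⟨hβ.1.rep w, fun i => ?_⟩
  have key : ∀ j : ℤ, bil M (rep cs w β) (rep cs (w ^ j) α) =
      bil M β (rep cs (w ^ (j - 1)) α) := fun j => by
    rw [← bil_rep (cs := cs) w β, ← rep_mul_apply, ← zpow_one_add, add_sub_cancel]
  rw [key, key, ← hβ.2 (i - 1)]
  congr 4
  ring

lemma bil_zpow_mul_eq {w : W} {α β : B → ℝ} {q : ℕ} (hβ : β ∈ periodicRoots cs w α q) (k : ℕ) :
    bil M β (rep cs (w ^ (q * k : ℤ)) α) = bil M β α := by
  induction k with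
  | zero => simp
  | succ k ih =>
    rw [← ih, ← hβ.2 (q * k)]
    congr 4

lemma exists_one_le_abs_bil {α : B → ℝ} (hα : IsRoot cs α) (v : W) :
    ∃ k : ℕ, 1 ≤ k ∧ 1 ≤ |bil M α (rep cs (v ^ k) α)| := by
  by_contra hcon
  push Not at hcon
  obtain ⟨q, hq, -, hper⟩ := exists_period (v := v) (hα.rep v) hα fun j _ => by
    rw [← rep_mul_apply, ← pow_succ]
    exact hcon (j + 1) (by omega)
  have h1 := hper (-1)
  have h2 := hcon q hq
  rw [← rep_mul_apply, ← rep_mul_apply, ← zpow_add_one, ← zpow_add_one, neg_add_cancel, zpow_zero,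
    rep_one_apply, hα.bil_self, show (-1 + (q : ℤ) + 1) = q by ring, zpow_natCast] at h1
  rw [h1, abs_one] at h2
  exact lt_irrefl _ h2

lemma IsOdd.exists_sign_change {w : W} {K : ℕ} {α : B → ℝ} (hα : IsOdd cs w K α) {m : ℕ}
    (hm : 1 ≤ m) : ∃ i : ℤ, 0 ≤ rep cs (w ^ i) α ∧ ¬ 0 ≤ rep cs (w ^ (i + m)) α := by
  by_contra hcon
  push Not at hcon
  have key : ∀ n : ℕ, 0 ≤ rep cs (w ^ (-K + m * n : ℤ)) α := by
    intro n
    induction n with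
    | zero => exact hα.2.1 _ (by simp)
    | succ n ih =>
      have := hcon _ ih
      push_cast
      rwa [mul_add, mul_one, ← add_assoc]
  refine hα.2.2 _ ?_ (key (2 * K))
  push_cast
  nlinarith

lemma IsEssential.finite_periodicRoots (hirr : (coxeterGraph M).Connected)
    (hform : ¬ ∀ x : B → ℝ, 0 ≤ canonicalForm M x x) {w : W} (hw : IsEssential cs w) {K : ℕ}
    {α : B → ℝ} (hα : IsOdd cs w K α) {q : ℕ} (hq : 1 ≤ q) : (periodicRoots cs w α q).Finite := by
  obtain ⟨k, hk, hbil⟩ := exists_one_le_abs_bil hα.1 (w ^ q)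
  rw [← pow_mul] at hbil
  have hroot := hα.1.rep (w ^ (q * k))
  have htrans : ∀ i : ℤ, rep cs (w ^ i) (rep cs (w ^ (q * k)) α) =
      rep cs (w ^ (i + (q * k : ℕ))) α := fun i => by
    rw [← zpow_natCast, rep_zpow_rep_zpow]
  have hlt : -1 < bil M α (rep cs (w ^ (q * k)) α) := by
    refine hα.1.neg_one_lt_bil hroot (x := w ^ (-(K + (q * k : ℕ)) : ℤ)) (y := w ^ (K : ℤ))
      (hα.2.1 _ (by omega)) ?_ (hα.2.2 _ le_rfl) ?_
    · rw [htrans]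
      exact hα.2.1 _ (by omega)
    · rw [htrans]
      exact hα.2.2 _ (by omega)
  have hge : 1 ≤ bil M α (rep cs (w ^ (q * k)) α) := by
    rcases le_abs.mp hbil with h | h
    · exact h
    · linarith
  obtain ⟨i, hi, hi'⟩ := hα.exists_sign_change (m := q * k) (Nat.mul_pos hq hk)
  refine hw.finite_of_orthogonal_pair hirr hform hα.1 hroot.neg (x := w ^ i)
    (by rw [map_neg]; linarith) hi ?_ (fun y hy => hy.1) (fun y hy => rep_mem_periodicRoots hy) ?_
  · rw [map_neg, htrans, (hα.1.rep _).neg_nonneg_iff]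
    exact hi'
  · intro y hy
    have := bil_zpow_mul_eq hy k
    rw [bil_symm, map_add, map_neg, ← this, ← zpow_natCast]
    push_cast
    ring

lemma IsEssential.finite_crossingRoots (hirr : (coxeterGraph M).Connected)
    (hform : ¬ ∀ x : B → ℝ, 0 ≤ canonicalForm M x x) {w : W} (hw : IsEssential cs w) {K : ℕ}
    {α : B → ℝ} (hα : IsOdd cs w K α) : (crossingRoots cs w α).Finite := by
  refine ((Set.finite_Icc 1 (windowBound cs)).biUnion (t := periodicRoots cs w α)
    fun q hq => hw.finite_periodicRoots hirr hform hα hq.1).subset fun β hβ => ?_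
  obtain ⟨q, h1, h2, hq⟩ := exists_period hα.1 hβ.1 hβ.2
  exact Set.mem_biUnion ⟨h1, h2⟩ ⟨hβ.1, hq⟩

end FinitelyManyCrossings

section Centralizer

variable [Fintype B] {M : CoxeterMatrix B} {cs : CoxeterSystem M W}

lemma rep_rep_of_commute {g h : W} (hgh : Commute g h) (v : B → ℝ) :
    rep cs g (rep cs h v) = rep cs h (rep cs g v) := by
  rw [← rep_mul_apply, hgh.eq, rep_mul_apply]

/-- Two roots whose product is at least `1` span nested half-spaces. -/
lemma IsRoot.nested_of_one_le_bil {a b : B → ℝ} (ha : IsRoot cs a) (hb : IsRoot cs b)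
    (hab : 1 ≤ bil M a b) :
    (∀ y, 0 ≤ CoxeterPaper.rep cs y a → 0 ≤ CoxeterPaper.rep cs y b) ∨
      ∀ y, 0 ≤ CoxeterPaper.rep cs y b → 0 ≤ CoxeterPaper.rep cs y a := by
  by_contra hcon
  push Not at hcon
  obtain ⟨⟨x, hxa, hxb⟩, y, hyb, hya⟩ := hcon
  have hneg : ∀ z, 0 ≤ CoxeterPaper.rep cs z (-b) ↔ ¬ 0 ≤ CoxeterPaper.rep cs z b := fun z => by
    rw [map_neg, (hb.rep z).neg_nonneg_iff]
  rcases ha.nonneg_or_nonneg_of_bil_le hb.neg (by rw [map_neg]; linarith) hxa ((hneg x).mpr hxb) y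
    with h | h
  · exact hya h
  · exact (hneg y).mp h hyb

lemma IsOdd.injective {w : W} {K : ℕ} {α : B → ℝ} (hα : IsOdd cs w K α) :
    Function.Injective fun k : ℤ => rep cs (w ^ k) α := by
  intro i j hij
  by_contra hne
  have hp := rep_zpow_sub_eq_self hij
  have hper : ∀ m : ℤ, rep cs (w ^ ((i - j) * m)) α = α := fun m => by
    rw [zpow_mul, rep_zpow_eq_self hp]
  have hd : 0 < (i - j) * (i - j) := mul_self_pos.mpr (sub_ne_zero.mpr hne)
  refine hα.2.2 ((i - j) * ((i - j) * K)) (by nlinarith) ?_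
  rw [hper, ← hper (-((i - j) * K))]
  exact hα.2.1 _ (by nlinarith)

lemma IsOdd.rep_commute {w : W} {K : ℕ} {α : B → ℝ} (hα : IsOdd cs w K α) {g : W}
    (hg : Commute g w) : ∃ K', IsOdd cs w K' (rep cs g α) := by
  have hfin : {k : ℤ | rep cs (w ^ k) α ∈ Inv cs g ∪ Neg.neg '' Inv cs g}.Finite :=
    ((inv_finite cs g).union ((inv_finite cs g).image _)).preimage hα.injective.injOn
  obtain ⟨L, hL⟩ := (hfin.image Int.natAbs).bddAbove
  have hbd : ∀ k : ℤ, L < k.natAbs →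
      (0 ≤ rep cs (w ^ k) (rep cs g α) ↔ 0 ≤ rep cs (w ^ k) α) := by
    intro k hk
    have hr := hα.1.rep (w ^ k)
    have hnot : ¬ rep cs (w ^ k) α ∈ Inv cs g ∪ Neg.neg '' Inv cs g := fun h => by
      have := hL ⟨k, h, rfl⟩
      omega
    rw [← rep_rep_of_commute (hg.zpow_right k)]
    by_contra hc
    refine hnot ?_
    by_cases h0 : 0 ≤ rep cs (w ^ k) α
    · exact Or.inl ⟨hr, h0, by tauto⟩
    · refine Or.inr ⟨-rep cs (w ^ k) α, ⟨hr.neg, hr.neg_nonneg_iff.mpr h0, ?_⟩, neg_neg _⟩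
      rw [map_neg, (hr.rep g).neg_nonneg_iff]
      tauto
  refine ⟨K + L + 1, hα.1.rep g, fun k hk => ?_, fun k hk => ?_⟩
  · rw [hbd k (by omega)]
    exact hα.2.1 k (by omega)
  · rw [hbd k (by omega)]
    exact hα.2.2 k (by omega)

lemma exists_notMem_of_injective {E : Type*} {X : Set E} (hX : X.Finite) {f : ℤ → E}
    (hf : Function.Injective f) (k : ℤ) : ∃ e : ℕ, e ≤ X.ncard ∧ f (k + e) ∉ X := by
  by_contra hcon
  push Not at hcon
  have hsub : (fun e : ℕ => f (k + e)) '' Set.Iic X.ncard ⊆ X := by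
    rintro _ ⟨e, he, rfl⟩
    exact hcon e he
  have hinj : Function.Injective fun e : ℕ => f (k + e) := fun a b h => by
    have := hf h
    omega
  have := Set.ncard_le_ncard hsub hX
  rw [Set.ncard_image_of_injective _ hinj, ← Finset.coe_Iic, Set.ncard_coe_finset,
    Nat.card_Iic] at this
  omega

lemma exists_one_le_abs_of_notMem {w : W} {α β : B → ℝ} (hβ : IsRoot cs β)
    (h : β ∉ crossingRoots cs w α) :
    ∃ j : ℕ, j ≤ windowBound cs ∧ 1 ≤ |bil M β (rep cs (w ^ (j : ℤ)) α)| := by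
  by_contra hcon
  push Not at hcon
  refine h ⟨hβ, fun j hj => ?_⟩
  rw [← zpow_natCast]
  exact hcon j hj

lemma finite_separating (x y : W) :
    {γ | IsRoot cs γ ∧ 0 ≤ rep cs x γ ∧ ¬ 0 ≤ rep cs y γ}.Finite := by
  refine ((inv_finite cs (y * x⁻¹)).image (rep cs x⁻¹)).subset fun γ hγ =>
    ⟨rep cs x γ, ⟨hγ.1.rep x, hγ.2.1, ?_⟩, rep_inv_rep cs x γ⟩
  rw [rep_mul_apply, rep_inv_rep]
  exact hγ.2.2

lemma IsOdd.nested {w : W} {K K' : ℕ} {α β : B → ℝ} (hα : IsOdd cs w K α)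
    (hβ : IsOdd cs w K' β) {i j : ℤ}
    (h : 1 ≤ |bil M (rep cs (w ^ i) β) (rep cs (w ^ j) α)|) :
    (∀ y, 0 ≤ rep cs y (rep cs (w ^ j) α) → 0 ≤ rep cs y (rep cs (w ^ i) β)) ∨
      ∀ y, 0 ≤ rep cs y (rep cs (w ^ i) β) → 0 ≤ rep cs y (rep cs (w ^ j) α) := by
  have hb := hβ.1.rep (w ^ i)
  have ha := hα.1.rep (w ^ j)
  have hlt := hb.neg_one_lt_bil ha (x := w ^ (-(K + K' + i.natAbs + j.natAbs) : ℤ))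
    (y := w ^ (K + K' + i.natAbs + j.natAbs : ℤ))
    (by rw [rep_zpow_rep_zpow]; exact hβ.2.1 _ (by omega))
    (by rw [rep_zpow_rep_zpow]; exact hα.2.1 _ (by omega))
    (by rw [rep_zpow_rep_zpow]; exact hβ.2.2 _ (by omega))
    (by rw [rep_zpow_rep_zpow]; exact hα.2.2 _ (by omega))
  refine Or.symm (hb.nested_of_one_le_bil ha ?_)
  rcases le_abs.mp h with h | h
  · exact h
  · linarith

/-- Up to powers of `w`, the elements commuting with `w` map `α` to finitely many roots. -/
lemma IsOdd.exists_finite_translates {w : W} {K : ℕ} {α : B → ℝ} (hα : IsOdd cs w K α)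
    (hX : (crossingRoots cs w α).Finite) : ∃ F : Set (B → ℝ), F.Finite ∧
      ∀ g, Commute g w → ∃ k : ℤ, rep cs (w ^ k) (rep cs g α) ∈ F := by
  set N := windowBound cs with hN
  set n := (crossingRoots cs w α).ncard with hn
  refine ⟨_, finite_separating (cs := cs) (w ^ (-K - N : ℤ)) (w ^ (K + n + 1 : ℤ)),
    fun g hg => ?_⟩
  obtain ⟨K', hβ⟩ := hα.rep_commute hg
  set β := rep cs g α with hβdef
  have hinj := hβ.injective
  set P : ℤ → Prop := fun k => ∃ j : ℕ, j ≤ N ∧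
    ∀ y, 0 ≤ rep cs y (rep cs (w ^ (j : ℤ)) α) → 0 ≤ rep cs y (rep cs (w ^ k) β) with hP
  set Q : ℤ → Prop := fun k => ∃ j : ℕ, j ≤ N ∧
    ∀ y, 0 ≤ rep cs y (rep cs (w ^ k) β) → 0 ≤ rep cs y (rep cs (w ^ (j : ℤ)) α) with hQ
  have hPQ : ∀ k, rep cs (w ^ k) β ∉ crossingRoots cs w α → P k ∨ Q k := by
    intro k hk
    obtain ⟨j, hj, hbil⟩ := exists_one_le_abs_of_notMem (hβ.1.rep _) hk
    exact (hα.nested hβ hbil).imp (fun h => ⟨j, hj, h⟩) fun h => ⟨j, hj, h⟩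
  have hPside : ∀ k, P k → 0 ≤ rep cs (w ^ (-K - N : ℤ)) (rep cs (w ^ k) β) := by
    rintro k ⟨j, hj, h⟩
    refine h _ ?_
    rw [rep_zpow_rep_zpow]
    exact hα.2.1 _ (by omega)
  have hPbdd : ∀ k, P k → k ≤ K + N + K' := by
    intro k hk
    have := hPside k hk
    rw [rep_zpow_rep_zpow] at this
    by_contra hlt
    exact hβ.2.2 _ (by omega) this
  have hQbdd : ∀ k, Q k → -K - K' < k := by
    rintro k ⟨j, hj, h⟩
    by_contra hlt
    have := h (w ^ (K : ℤ)) (by rw [rep_zpow_rep_zpow]; exact hβ.2.1 _ (by omega))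
    rw [rep_zpow_rep_zpow] at this
    exact hα.2.2 _ (by omega) this
  obtain ⟨k, hk, hmax⟩ : ∃ k, P k ∧ ∀ z, P z → z ≤ k := by
    refine Int.exists_greatest_of_bdd ⟨_, hPbdd⟩ ?_
    obtain ⟨e, he, hnot⟩ := exists_notMem_of_injective hX hinj (-K - K' - n)
    exact ⟨_, (hPQ _ hnot).resolve_right fun h => by have := hQbdd _ h; omega⟩
  obtain ⟨e, he, hnot⟩ := exists_notMem_of_injective hX hinj (k + 1)
  obtain ⟨j, hj, hsub⟩ := (hPQ _ hnot).resolve_left fun h => by have := hmax _ h; omega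
  refine ⟨k, hβ.1.rep _, hPside k hk, fun hcon => ?_⟩
  have := hsub (w ^ (K + n - e : ℤ)) (by
    rw [rep_zpow_rep_zpow] at hcon ⊢
    rwa [show (K + n - e : ℤ) + (k + 1 + e) = K + n + 1 + k by ring])
  rw [rep_zpow_rep_zpow] at this
  exact hα.2.2 _ (by omega) this

lemma IsOdd.finite_commute_stabilizer {w : W} {K : ℕ} {α : B → ℝ} (hα : IsOdd cs w K α)
    (hX : (crossingRoots cs w α).Finite) : {g | Commute g w ∧ rep cs g α = α}.Finite := by
  set N := windowBound cs with hN
  set x := w ^ (-2 * K - N : ℤ) with hx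
  set X := crossingRoots cs w α with hXdef
  refine (finite_ncard_inv_le cs (X.ncard + (Inv cs x).ncard + (Inv cs x).ncard)).subset
    fun g hg => ?_
  obtain ⟨hg, hgα⟩ := hg
  have hgx : Commute g x := hg.zpow_right _
  have hgj : ∀ j : ℤ, rep cs g (rep cs (w ^ j) α) = rep cs (w ^ j) α := fun j => by
    rw [rep_rep_of_commute (hg.zpow_right j), hgα]
  have hfin : (rep cs (w ^ (K : ℤ)) '' X ∪ Inv cs x).Finite := (hX.image _).union (inv_finite cs x)
  have hfin' : ((fun v => -rep cs g⁻¹ v) '' Inv cs x).Finite := (inv_finite cs x).image _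
  have hsub : Inv cs g ⊆ rep cs (w ^ (K : ℤ)) '' X ∪ Inv cs x ∪
      (fun v => -rep cs g⁻¹ v) '' Inv cs x := by
    rintro β ⟨hβ, h0, hneg⟩
    by_contra hcon
    rw [Set.mem_union, Set.mem_union, not_or, not_or] at hcon
    obtain ⟨⟨h1, h2⟩, h3⟩ := hcon
    have hxβ : 0 ≤ rep cs x β := by
      by_contra h
      exact h2 ⟨hβ, h0, h⟩
    have hgxβ : ¬ 0 ≤ rep cs g (rep cs x β) := fun h => h3 ⟨-rep cs g β,
      ⟨(hβ.rep g).neg, (hβ.rep g).neg_nonneg_iff.mpr hneg, by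
        rw [map_neg, ((hβ.rep g).rep x).neg_nonneg_iff, not_not, ← rep_rep_of_commute hgx]
        exact h⟩, by simp only; rw [map_neg, rep_inv_rep, neg_neg]⟩
    obtain ⟨j, hj, hbil⟩ := exists_one_le_abs_of_notMem (hβ.rep (w ^ (-K : ℤ))) fun h =>
      h1 ⟨_, h, by rw [rep_zpow_rep_zpow, add_neg_cancel, zpow_zero, rep_one_apply]⟩
    rw [← bil_rep (cs := cs) (w ^ (K : ℤ)), rep_zpow_rep_zpow, rep_zpow_rep_zpow, add_neg_cancel,
      zpow_zero, rep_one_apply] at hbil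
    set a := rep cs (w ^ (K + j : ℤ)) α with ha
    have haroot : IsRoot cs a := hα.1.rep _
    have hga : rep cs g a = a := hgj _
    have haneg : ¬ 0 ≤ a := hα.2.2 _ (by omega)
    have hxa : 0 ≤ rep cs x a := by
      rw [hx, ha, rep_zpow_rep_zpow]
      exact hα.2.1 _ (by omega)
    rcases le_abs.mp hbil with h | h
    · rcases hβ.nested_of_one_le_bil haroot h with h | h
      · exact haneg (by have := h 1; rw [rep_one_apply, rep_one_apply] at this; exact this h0)
      · refine hgxβ ?_
        have := h (g * x)
        rw [rep_mul_apply, rep_mul_apply, rep_rep_of_commute hgx a, hga] at this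
        exact this hxa
    · rcases hβ.nonneg_or_nonneg_of_bil_le haroot (by linarith) hxβ hxa g with h | h
      · exact hneg h
      · rw [hga] at h
        exact haneg h
  calc (Inv cs g).ncard ≤ _ := Set.ncard_le_ncard hsub (hfin.union hfin')
    _ ≤ _ := Set.ncard_union_le _ _
    _ ≤ _ := add_le_add ((Set.ncard_union_le _ _).trans
        (add_le_add_left (Set.ncard_image_le hX) _)) (Set.ncard_image_le (inv_finite cs x))

lemma finiteIndex_zpowers_of_finite {w : W} {R : Set W} (hR : R.Finite)
    (h : ∀ g, Commute g w → ∃ k : ℤ, w ^ k * g ∈ R) :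
    ((Subgroup.zpowers w).subgroupOf (Subgroup.centralizer {w})).FiniteIndex := by
  set C := Subgroup.centralizer {w}
  have : Finite {c : C // (c : W) ∈ R} :=
    (hR.preimage Subtype.val_injective.injOn).to_subtype
  have hsurj : Function.Surjective fun c : {c : C // (c : W) ∈ R} =>
      (QuotientGroup.mk c.1 : C ⧸ (Subgroup.zpowers w).subgroupOf C) := by
    intro q
    induction q using QuotientGroup.induction_on with
    | H c =>
    have hc : Commute (c : W) w := Subgroup.mem_centralizer_singleton_iff.mp c.2
    obtain ⟨k, hk⟩ := h c hc
    have hw : w ^ k ∈ C :=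
      Subgroup.mem_centralizer_singleton_iff.mpr ((Commute.refl w).zpow_left k).eq
    refine ⟨⟨⟨w ^ k, hw⟩ * c, hk⟩, QuotientGroup.eq.mpr ?_⟩
    rw [Subgroup.mem_subgroupOf]
    refine Subgroup.mem_zpowers_iff.mpr ⟨-k, ?_⟩
    have := hc.zpow_right k
    push_cast
    rw [mul_inv_rev, zpow_neg, mul_assoc, (this.inv_right).symm.eq, ← mul_assoc, inv_mul_cancel,
      one_mul]
  have := Finite.of_surjective _ hsurj
  exact Subgroup.finiteIndex_of_finite_quotient

end Centralizer
/-- In an irreducible, non-spherical, non-affine Coxeter system, the cyclic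
subgroup generated by an essential element `w` has finite index in the centralizer of `w`. -/
theorem zpowers_finiteIndex_in_centralizer_of_essential
    [Fintype B] {M : CoxeterMatrix B} (cs : CoxeterSystem M W)
    (hirr : (coxeterGraph M).Connected) (hinf : Infinite W)
    (hform : ¬ ∀ x : B → ℝ, 0 ≤ canonicalForm M x x)
    (w : W) (hw : IsEssential cs w) :
    ((Subgroup.zpowers w).subgroupOf (Subgroup.centralizer {w})).FiniteIndex := by
  obtain ⟨α, K, hα⟩ := exists_isOdd (cs := cs) hw.not_isOfFinOrder
  have hX := hw.finite_crossingRoots hirr hform hα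
  obtain ⟨F, hF, htrans⟩ := hα.exists_finite_translates hX
  have hR : (⋃ γ ∈ F, {g | Commute g w ∧ rep cs g α = γ}).Finite := by
    refine hF.biUnion fun γ _ => ?_
    rcases Set.eq_empty_or_nonempty {g | Commute g w ∧ rep cs g α = γ} with h | ⟨h, hh, hhα⟩
    · rw [h]
      exact Set.finite_empty
    · refine ((hα.finite_commute_stabilizer hX).image (h * ·)).subset fun g hg =>
        ⟨h⁻¹ * g, ⟨hh.inv_left.mul_left hg.1, ?_⟩, mul_inv_cancel_left h g⟩
      rw [rep_mul_apply, hg.2, ← hhα, rep_inv_rep]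
  refine finiteIndex_zpowers_of_finite hR fun g hg => ?_
  obtain ⟨k, hk⟩ := htrans g hg
  exact ⟨k, Set.mem_biUnion hk ⟨((Commute.refl w).zpow_left k).mul_left hg, rep_mul_apply cs _ _ _⟩⟩

end CoxeterPaper
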